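/- Let a, b, c be positive integers and let B = k[x,y,z] = k^[3] be endowed with the ℕ-grading in which x, y, z are homogeneous of degrees a, b, c. Let D be an irreducible homogeneous locally nilpotent derivation of B, D ≠ 0. Then: (a) there exist homogeneous F, G ∈ B with ker D = k[F,G]; (b) if d = deg F and e = deg G then the degree of D (the integer m with D(B_i) ⊆ B_{i+m} for all i) equals (d + e) − (a + b + c). -/

import Mathlib

open MvPolynomial

set_option synthInstance.maxHeartbeats 400000
set_option maxHeartbeats 1000000

noncomputable section

/-- `D` is a locally nilpotent derivation: every element is killed by some power of `D`. -/
def IsLND {k B : Type*} [CommRing k] [CommRing B] [Algebra k B]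
    (D : Derivation k B B) : Prop :=
  ∀ b : B, ∃ n : ℕ, (⇑D)^[n] b = 0

/-- A derivation `D` is irreducible if the only principal ideal of `B` containing the
image of `D` is `B` itself. -/
def IsIrreducibleDeriv {k B : Type*} [CommRing k] [CommRing B] [Algebra k B]
    (D : Derivation k B B) : Prop :=
  ∀ b : B, (∀ r : B, D r ∈ Ideal.span {b}) → IsUnit b

/-- `D` is a homogeneous derivation of degree `m` with respect to the `ℕ`-grading of
`k[x,y,z]` in which the variables have weights `w`, i.e. `D(R_i) ⊆ R_{i+m}` for all `i`. -/
def DerivIsHomogOfDeg {k : Type} [Field k] (w : Fin 3 → ℕ)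
    (D : Derivation k (MvPolynomial (Fin 3) k) (MvPolynomial (Fin 3) k)) (m : ℤ) : Prop :=
  ∀ (i : ℕ) (f : MvPolynomial (Fin 3) k), f.IsWeightedHomogeneous w i →
    (∀ j : ℕ, (j : ℤ) = (i : ℤ) + m → (D f).IsWeightedHomogeneous w j) ∧
    ((i : ℤ) + m < 0 → D f = 0)


set_option linter.all false

namespace MZ

section LND
variable {k B : Type*} [Field k] [CharZero k] [CommRing B] [IsDomain B] [Algebra k B]
  {D : Derivation k B B}

lemma iter_zero (D : Derivation k B B) (n : ℕ) : (⇑D)^[n] 0 = 0 := by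
  induction n with
  | zero => rfl
  | succ n ih => rw [Function.iterate_succ_apply, map_zero, ih]

lemma iter_add (D : Derivation k B B) (n : ℕ) (a b : B) :
    (⇑D)^[n] (a + b) = (⇑D)^[n] a + (⇑D)^[n] b := by
  induction n generalizing a b with
  | zero => rfl
  | succ n ih => simp only [Function.iterate_succ_apply, map_add, ih]

lemma iter_ker_mul (n : ℕ) (a b : B) (h : D a = 0) :
    (⇑D)^[n] (a * b) = a * (⇑D)^[n] b := by
  induction n generalizing b with
  | zero => rfl
  | succ n ih =>
    simp only [Function.iterate_succ_apply]
    rw [Derivation.leibniz, h, smul_zero, add_zero, smul_eq_mul, ih]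

lemma iter_mul : ∀ (t m n : ℕ) (a b : B), m + n = t → (⇑D)^[m+1] a = 0 → (⇑D)^[n+1] b = 0 →
    (⇑D)^[m+n] (a * b) = ((m+n).choose m : B) * ((⇑D)^[m] a * (⇑D)^[n] b) := by
  intro t
  induction t with
  | zero =>
    intro m n a b h ha hb
    obtain ⟨rfl, rfl⟩ : m = 0 ∧ n = 0 := by omega
    simp
  | succ t ih =>
    intro m n a b h ha hb
    rcases Nat.eq_zero_or_pos m with rfl | hm
    · simp only [zero_add, Function.iterate_one] at ha
      simp [iter_ker_mul n a b ha]
    rcases Nat.eq_zero_or_pos n with rfl | hn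
    · simp only [zero_add, Function.iterate_one] at hb
      rw [mul_comm a b, add_zero, iter_ker_mul m b a hb]
      simp [mul_comm]
    obtain ⟨m, rfl⟩ : ∃ m', m = m' + 1 := ⟨m - 1, by omega⟩
    obtain ⟨n, rfl⟩ : ∃ m', n = m' + 1 := ⟨n - 1, by omega⟩
    have h1 := ih (m+1) n a (D b) (by omega) ha (by rwa [← Function.iterate_succ_apply])
    have h2 := ih m (n+1) (D a) b (by omega) (by rwa [← Function.iterate_succ_apply]) hb
    have e1 : m + 1 + (n + 1) = (m + 1 + n) + 1 := by ring
    have e2 : m + (n + 1) = m + 1 + n := by ring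
    rw [e2] at h2
    rw [e1, Function.iterate_succ_apply, Derivation.leibniz, iter_add, smul_eq_mul, smul_eq_mul,
      h1, mul_comm b, h2, Nat.choose_succ_succ, ← Function.iterate_succ_apply,
      ← Function.iterate_succ_apply]
    push_cast
    ring

lemma exists_order (h : IsLND D) (a : B) (ha : a ≠ 0) :
    ∃ m, (⇑D)^[m] a ≠ 0 ∧ (⇑D)^[m+1] a = 0 := by
  classical
  have hf := Nat.find_spec (h a)
  have hmin : ∀ m, m < Nat.find (h a) → (⇑D)^[m] a ≠ 0 := fun m hm => Nat.find_min (h a) hm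
  rcases hN : Nat.find (h a) with _ | n
  · rw [hN] at hf; exact absurd hf ha
  · rw [hN] at hf hmin
    exact ⟨n, hmin n (by omega), hf⟩

lemma iter_mul_ne [CharZero B] {a b : B} {m n : ℕ} (ha : (⇑D)^[m] a ≠ 0) (ha' : (⇑D)^[m+1] a = 0)
    (hb : (⇑D)^[n] b ≠ 0) (hb' : (⇑D)^[n+1] b = 0) : (⇑D)^[m+n] (a * b) ≠ 0 := by
  rw [iter_mul _ m n a b rfl ha' hb']
  exact mul_ne_zero (Nat.cast_ne_zero.2 (Nat.choose_pos (by omega)).ne') (mul_ne_zero ha hb)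

lemma ker_of_mul [CharZero B] (h : IsLND D) {a b : B} (hab : a * b ≠ 0) (hD : D (a * b) = 0) : D a = 0 := by
  obtain ⟨m, hm, hm'⟩ := exists_order h a (left_ne_zero_of_mul hab)
  obtain ⟨n, hn, hn'⟩ := exists_order h b (right_ne_zero_of_mul hab)
  have := iter_mul_ne hm hm' hn hn'
  rcases Nat.eq_zero_or_pos m with rfl | hm0
  · simpa using hm'
  · exfalso
    apply this
    obtain ⟨t, ht⟩ : ∃ t, m + n = t + 1 := ⟨m + n - 1, by omega⟩
    rw [ht, Function.iterate_succ_apply, hD, iter_zero]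

lemma ker_of_dvd [CharZero B] (h : IsLND D) {a b : B} (hb : b ≠ 0) (hD : D b = 0) (hab : a ∣ b) : D a = 0 := by
  obtain ⟨c, rfl⟩ := hab
  exact ker_of_mul h hb hD

lemma ker_of_dvd_self [CharZero B] (h : IsLND D) {q : B} (hq : q ∣ D q) : D q = 0 := by
  by_contra hne
  obtain ⟨r, hr⟩ := hq
  have hq0 : q ≠ 0 := by rintro rfl; simp at hne
  have hr0 : r ≠ 0 := by rintro rfl; exact hne (by simp [hr])
  obtain ⟨m, hm, hm'⟩ := exists_order h q hq0
  obtain ⟨n, hn, hn'⟩ := exists_order h r hr0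
  apply iter_mul_ne hm hm' hn hn'
  rw [← hr, ← Function.iterate_succ_apply]
  have : (m + n).succ = n + (m+1) := by simp; ring
  rw [this, Function.iterate_add_apply, hm', iter_zero]

lemma exists_slice (h : IsLND D) (hD : D ≠ 0) : ∃ s, D s ≠ 0 ∧ D (D s) = 0 := by
  obtain ⟨x, hx⟩ : ∃ x, D x ≠ 0 := by
    by_contra hc; push Not at hc; exact hD (Derivation.ext hc)
  obtain ⟨m, hm, hm'⟩ := exists_order h (D x) hx
  refine ⟨(⇑D)^[m] x, ?_, ?_⟩
  · rwa [← Function.iterate_succ_apply' (⇑D), Function.iterate_succ_apply]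
  · rwa [← Function.iterate_succ_apply' (⇑D), ← Function.iterate_succ_apply' (⇑D), Function.iterate_succ_apply]

/-- the kernel as a subalgebra -/
def kerA (D : Derivation k B B) : Subalgebra k B where
  carrier := {f | D f = 0}
  mul_mem' := by
    intro a b ha hb
    simp only [Set.mem_ofPred_eq] at *
    simp [Derivation.leibniz, ha, hb]
  add_mem' := by
    intro a b ha hb
    simp only [Set.mem_ofPred_eq] at *
    simp [ha, hb]
  algebraMap_mem' := by intro r; simp

lemma mem_kerA {f : B} : f ∈ kerA D ↔ D f = 0 := Iff.rfl

lemma deriv_aeval_ker (P : Polynomial (kerA D)) (s : B) :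
    D (Polynomial.aeval s P) = Polynomial.aeval s (Polynomial.derivative P) * D s := by
  induction P using Polynomial.induction_on' with
  | add p q hp hq => simp [hp, hq, add_mul]
  | monomial n a =>
    have ha : D (a : B) = 0 := a.2
    simp only [Polynomial.aeval_monomial, Polynomial.derivative_monomial, Derivation.leibniz,
      Derivation.leibniz_pow]
    have : (algebraMap (kerA D) B) a = (a : B) := rfl
    simp only [map_mul, map_natCast, this, ha, smul_eq_mul, nsmul_eq_mul]
    ring

lemma slice_transc [CharZero B] {s : B} (h1 : D s ≠ 0) : Transcendental (kerA D) s := by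
  have key : ∀ n (P : Polynomial (kerA D)), P.natDegree = n → Polynomial.aeval s P = 0 → P = 0 := by
    intro n
    induction n with
    | zero =>
      intro P hP h0
      rw [Polynomial.natDegree_eq_zero] at hP
      obtain ⟨a, rfl⟩ := hP
      rw [Polynomial.aeval_C] at h0
      have : a = 0 := Subtype.ext h0
      simp [this]
    | succ n ih =>
      intro P hP h0
      have hd := deriv_aeval_ker P s
      rw [h0, map_zero] at hd
      have hd' : Polynomial.aeval s (Polynomial.derivative P) = 0 :=
        (mul_eq_zero.1 hd.symm).resolve_right h1
      have hc : CharZero (kerA D) := ⟨fun a b hab => by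
        have := congrArg (fun x : kerA D => (x : B)) hab
        simpa using this⟩
      have := ih (Polynomial.derivative P) (by rw [Polynomial.natDegree_derivative, hP]; rfl) hd'
      have h3 := Polynomial.derivative_eq_zero.1 this
      omega
  rintro ⟨P, hP, h0⟩
  exact hP (key _ P rfl h0)

lemma slice_span [CharZero B] (h : IsLND D) {s : B} (h1 : D s ≠ 0) (h2 : D (D s) = 0) (b : B) :
    ∃ N, (D s)^N * b ∈ Algebra.adjoin (kerA D) {s} := by
  obtain ⟨n, hn⟩ := h b
  induction n generalizing b with
  | zero => exact ⟨0, by simp at hn; simp [hn]⟩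
  | succ n ih =>
    obtain ⟨N, hN⟩ := ih (D b) (by rwa [← Function.iterate_succ_apply])
    -- (Ds)^N * D b = P(s); 
    rw [Algebra.adjoin_singleton_eq_range_aeval] at hN
    obtain ⟨P, hP⟩ := hN
    -- antiderivative over kerA (a k-algebra)
    obtain ⟨Q, hQ⟩ : ∃ Q : Polynomial (kerA D), Polynomial.derivative Q = P := by
      clear hP
      induction P using Polynomial.induction_on' with
      | add p q hp hq =>
        obtain ⟨a, rfl⟩ := hp; obtain ⟨b, rfl⟩ := hq; exact ⟨a + b, by simp⟩
      | monomial m a =>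
        refine ⟨Polynomial.monomial (m+1) (((m+1 : k)⁻¹) • a), ?_⟩
        rw [Polynomial.derivative_monomial]
        simp only [Nat.add_sub_cancel]
        congr 1
        have : ((m + 1 : ℕ) : kerA D) = algebraMap k (kerA D) (m+1) := by simp
        rw [this, mul_comm, ← Algebra.smul_def, smul_smul, mul_inv_cancel₀ (by exact_mod_cast Nat.succ_ne_zero m), one_smul]
    have hb : D ((D s)^(N+1) * b - Polynomial.aeval s Q) = 0 := by
      rw [map_sub, deriv_aeval_ker, hQ]
      simp only [Derivation.leibniz, Derivation.leibniz_pow, h2, smul_zero, smul_eq_mul, mul_zero, add_zero]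
      have hP' : (Polynomial.aeval s) P = D s ^ N * D b := hP
      rw [hP']
      ring
    refine ⟨N+1, ?_⟩
    have : (D s)^(N+1) * b = Polynomial.aeval s (Q + Polynomial.C (⟨_, hb⟩ : kerA D)) := by
      simp only [map_add, Polynomial.aeval_C]
      change _ = _ + ((D s)^(N+1) * b - Polynomial.aeval s Q)
      ring
    rw [this, Algebra.adjoin_singleton_eq_range_aeval]
    exact ⟨_, rfl⟩

end LND
end MZ

namespace MZ

section TR
variable {k : Type} [Field k] [CharZero k]
  {D : Derivation k (MvPolynomial (Fin 3) k) (MvPolynomial (Fin 3) k)}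

lemma trdegB : Algebra.trdeg k (MvPolynomial (Fin 3) k) = 3 := by
  rw [MvPolynomial.trdeg_of_isDomain]; simp

lemma ker_algdep (h : IsLND D) (hD : D ≠ 0) (x : Fin 3 → MvPolynomial (Fin 3) k)
    (hx : ∀ i, D (x i) = 0) : ¬ AlgebraicIndependent k x := by
  intro hind
  obtain ⟨s, h1, h2⟩ := exists_slice h hD
  have hs := slice_transc (D := D) h1
  have hle : Algebra.adjoin k (Set.range x) ≤ kerA D := by
    rw [Algebra.adjoin_le_iff]; rintro _ ⟨i, rfl⟩; exact hx i
  have hs' : Transcendental (Algebra.adjoin k (Set.range x)) s := by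
    rintro ⟨P, hP, h0⟩
    apply hs
    refine ⟨P.map (Subalgebra.inclusion hle).toRingHom, ?_, ?_⟩
    · rw [Ne, Polynomial.map_eq_zero_iff (Subalgebra.inclusion_injective hle)]; exact hP
    · rw [← h0, Polynomial.aeval_def, Polynomial.aeval_def, Polynomial.eval₂_map]; rfl
  have := (AlgebraicIndependent.option_iff.2 ⟨hind, hs'⟩).cardinalMk_le_trdeg
  rw [trdegB] at this
  simp at this
  norm_num at this

lemma ker_not_single (h : IsLND D) (hD : D ≠ 0) (F : MvPolynomial (Fin 3) k) :
    ∃ r, D r = 0 ∧ r ∉ Algebra.adjoin k {F} := by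
  by_contra hc
  push Not at hc
  obtain ⟨s, h1, h2⟩ := exists_slice h hD
  have hle : kerA D ≤ Algebra.adjoin k {F} := fun r hr => hc r hr
  have hsub : ∀ y ∈ Algebra.adjoin (kerA D) {s}, y ∈ Algebra.adjoin k ({F, s} : Set (MvPolynomial (Fin 3) k)) := by
    intro y hy
    induction hy using Algebra.adjoin_induction with
    | mem x hx => exact Algebra.subset_adjoin (by simp at hx; simp [hx])
    | algebraMap r =>
      exact Algebra.adjoin_mono (by simp) (hle r.2)
    | add x y _ _ hx hy => exact add_mem hx hy
    | mul x y _ _ hx hy => exact mul_mem hx hy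
  have halg : Algebra.IsAlgebraic (Algebra.adjoin k ({F, s} : Set (MvPolynomial (Fin 3) k))) (MvPolynomial (Fin 3) k) := by
    refine ⟨fun b => ?_⟩
    obtain ⟨N, hN⟩ := slice_span h h1 h2 b
    have hc1 : (D s)^N ∈ Algebra.adjoin k ({F, s} : Set (MvPolynomial (Fin 3) k)) :=
      pow_mem (Algebra.adjoin_mono (by simp) (hle (h2 : D s ∈ kerA D))) N
    refine ⟨Polynomial.C ⟨_, hc1⟩ * Polynomial.X - Polynomial.C ⟨_, hsub _ hN⟩, ?_, ?_⟩
    · intro h0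
      have := congrArg (fun p => Polynomial.coeff p 1) h0
      simp [Polynomial.coeff_X, Polynomial.coeff_C] at this
      rw [Subtype.ext_iff] at this
      exact pow_ne_zero N h1 this
    · simp
  have := Algebra.IsAlgebraic.trdeg_le_cardinalMk k (A := MvPolynomial (Fin 3) k) ({F, s} : Set (MvPolynomial (Fin 3) k))
  rw [trdegB] at this
  have h2 : Cardinal.mk ({F, s} : Set (MvPolynomial (Fin 3) k)) ≤ 2 := by
    refine (Cardinal.mk_insert_le).trans ?_
    simp
    norm_num
  have := this.trans h2
  norm_num at this

end TR

section GR
variable {k : Type} [Field k] [CharZero k] {w : Fin 3 → ℕ}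


/-- scaling homomorphism -/
def Phi (w : Fin 3 → ℕ) : MvPolynomial (Fin 3) k →ₐ[k] Polynomial (MvPolynomial (Fin 3) k) :=
  aeval (fun i => Polynomial.C (X i) * Polynomial.X ^ (w i))

lemma Phi_monomial (d : Fin 3 →₀ ℕ) (r : k) :
    Phi w (monomial d r) = Polynomial.C (monomial d r) * Polynomial.X ^ (Finsupp.weight w d) := by
  have e1 : (d.prod fun i n => (Polynomial.C (X i : (MvPolynomial (Fin 3) k))) ^ n) = Polynomial.C (d.prod fun i n => (X i : (MvPolynomial (Fin 3) k))^n) := by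
    rw [Finsupp.prod, Finsupp.prod, map_prod]; simp only [map_pow]
  have e2 : (d.prod fun i n => (Polynomial.X : Polynomial (MvPolynomial (Fin 3) k)) ^ (w i * n)) = Polynomial.X ^ (Finsupp.weight w d) := by
    rw [Finsupp.weight_apply, Finsupp.prod, Finsupp.sum, ← Finset.prod_pow_eq_pow_sum]
    simp only [smul_eq_mul, mul_comm]
  rw [Phi, aeval_monomial, monomial_eq]
  simp only [mul_pow, Finsupp.prod_mul, ← pow_mul, map_mul, e1, e2]
  rw [← mul_assoc]
  rfl

lemma coeff_Phi (f : (MvPolynomial (Fin 3) k)) (n : ℕ) : (Phi w f).coeff n = weightedHomogeneousComponent w n f := by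
  induction f using MvPolynomial.induction_on' with
  | monomial d a =>
    rw [Phi_monomial, Polynomial.coeff_C_mul_X_pow,
      weightedHomogeneousComponent_of_mem (n := Finsupp.weight w d)
        ((mem_weightedHomogeneousSubmodule _ _ _ _).2 (isWeightedHomogeneous_monomial w d a rfl))]
  | add p q hp hq => simp [hp, hq]

lemma Phi_eval (f : (MvPolynomial (Fin 3) k)) : (Phi w f).eval 1 = f := by
  induction f using MvPolynomial.induction_on' with
  | monomial d a => rw [Phi_monomial]; simp
  | add p q hp hq => simp [hp, hq]

lemma Phi_ne {f : (MvPolynomial (Fin 3) k)} (hf : f ≠ 0) : Phi w f ≠ 0 := by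
  intro h; apply hf; rw [← Phi_eval (w := w) f, h]; simp

lemma Phi_homog {f : (MvPolynomial (Fin 3) k)} {n : ℕ} (hf : IsWeightedHomogeneous w f n) :
    Phi w f = Polynomial.C f * Polynomial.X ^ n := by
  ext1 m
  rw [coeff_Phi, Polynomial.coeff_C_mul_X_pow]
  split_ifs with h
  · rw [h]; exact hf.weightedHomogeneousComponent_same
  · exact hf.weightedHomogeneousComponent_ne _ h

lemma homog_of_Phi {f g : (MvPolynomial (Fin 3) k)} {n : ℕ} (hf : Phi w f = Polynomial.C g * Polynomial.X ^ n) :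
    IsWeightedHomogeneous w f n := by
  have h1 : g = f := by
    have := congrArg (Polynomial.eval 1) hf
    rw [Phi_eval] at this; simpa using this.symm
  subst h1
  have := coeff_Phi (w := w) g n
  rw [hf] at this
  simp at this
  rw [this]
  exact weightedHomogeneousComponent_isWeightedHomogeneous n g

lemma homog_of_mul {f g : (MvPolynomial (Fin 3) k)} {n : ℕ} (h : IsWeightedHomogeneous w (f * g) n) (h0 : f * g ≠ 0) :
    ∃ i j, IsWeightedHomogeneous w f i ∧ IsWeightedHomogeneous w g j ∧ i + j = n := by
  have hf := Phi_ne (w := w) (left_ne_zero_of_mul h0)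
  have hg := Phi_ne (w := w) (right_ne_zero_of_mul h0)
  have hm := Phi_homog h
  rw [map_mul] at hm
  have h1 := congrArg Polynomial.natDegree hm
  have h2 := congrArg Polynomial.natTrailingDegree hm
  rw [Polynomial.natDegree_mul hf hg, Polynomial.natDegree_C_mul_X_pow _ _ h0] at h1
  rw [Polynomial.natTrailingDegree_mul hf hg, Polynomial.C_mul_X_pow_eq_monomial,
    Polynomial.natTrailingDegree_monomial h0] at h2
  have h3 := Polynomial.natTrailingDegree_le_natDegree (Phi w f)
  have h4 := Polynomial.natTrailingDegree_le_natDegree (Phi w g)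
  have key : ∀ (p : Polynomial (MvPolynomial (Fin 3) k)), p.natTrailingDegree = p.natDegree →
      p = Polynomial.C (p.coeff p.natDegree) * Polynomial.X ^ p.natDegree := by
    intro p hp
    ext1 m
    rw [Polynomial.coeff_C_mul_X_pow]
    split_ifs with h
    · rw [h]
    · rcases lt_or_gt_of_ne h with h | h
      · exact Polynomial.coeff_eq_zero_of_lt_natTrailingDegree (by omega)
      · exact Polynomial.coeff_eq_zero_of_natDegree_lt h
  exact ⟨_, _, homog_of_Phi (key (Phi w f) (by omega)), homog_of_Phi (key (Phi w g) (by omega)), h1⟩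

lemma homog_of_dvd {f g : (MvPolynomial (Fin 3) k)} {n : ℕ} (h : IsWeightedHomogeneous w g n) (h0 : g ≠ 0) (hd : f ∣ g) :
    ∃ i, i ≤ n ∧ IsWeightedHomogeneous w f i := by
  obtain ⟨c, rfl⟩ := hd
  obtain ⟨i, j, hi, hj, h⟩ := homog_of_mul h h0
  exact ⟨i, by omega, hi⟩

lemma homog_unique {f : (MvPolynomial (Fin 3) k)} {m n : ℕ} (h0 : f ≠ 0) (h : IsWeightedHomogeneous w f m)
    (h' : IsWeightedHomogeneous w f n) : m = n := h.inj_right h0 h'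

lemma homog_zero_const (hw : ∀ i, 0 < w i) {f : (MvPolynomial (Fin 3) k)} (h : IsWeightedHomogeneous w f 0) : ∃ c, f = C c := by
  refine ⟨coeff 0 f, ?_⟩
  ext d
  rw [coeff_C]
  split_ifs with hd
  · rw [hd]
  · by_contra hne
    have h1 := h hne
    apply hd
    ext i
    have : d i • w i = 0 := by
      rw [Finsupp.weight_apply, Finsupp.sum_fintype _ _ (by simp)] at h1
      rw [Finset.sum_eq_zero_iff] at h1
      exact h1 i (Finset.mem_univ i)
    simp at this
    rcases this with h | h
    · simpa using h.symm
    · exact absurd h (hw i).ne'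

lemma dvd_comp {p f : (MvPolynomial (Fin 3) k)} {n : ℕ} (hp : IsWeightedHomogeneous w p n) (hd : p ∣ f) (m : ℕ) :
    p ∣ weightedHomogeneousComponent w m f := by
  obtain ⟨g, rfl⟩ := hd
  have h : Polynomial.C p ∣ Phi w (p * g) := by
    rw [map_mul, Phi_homog hp, mul_assoc]; exact dvd_mul_right _ _
  rw [Polynomial.C_dvd_iff_dvd_coeff] at h
  rw [← coeff_Phi]; exact h m

lemma mem_of_comp {S : Type*} [SetLike S (MvPolynomial (Fin 3) k)] [AddSubmonoidClass S (MvPolynomial (Fin 3) k)] (s : S) (f : (MvPolynomial (Fin 3) k))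
    (h : ∀ n, weightedHomogeneousComponent w n f ∈ s) : f ∈ s := by
  have h1 : f = ∑ i ∈ Finset.range ((Phi w f).natDegree + 1), weightedHomogeneousComponent w i f := by
    conv_lhs => rw [← Phi_eval (w := w) f, Polynomial.eval_eq_sum_range]
    simp [coeff_Phi]
  rw [h1]
  exact sum_mem fun i _ => h i

/-- Euler derivation -/
def eul (w : Fin 3 → ℕ) : Derivation k (MvPolynomial (Fin 3) k) (MvPolynomial (Fin 3) k) := mkDerivation k (fun i => (w i : k) • X i)

lemma eul_apply (f : (MvPolynomial (Fin 3) k)) : eul w f = ∑ i, (w i : k) • (X i * pderiv i f) := by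
  have : (eul w : Derivation k (MvPolynomial (Fin 3) k) (MvPolynomial (Fin 3) k)) = (w 0 : k) • ((X 0 : (MvPolynomial (Fin 3) k)) • pderiv 0) +
      (w 1 : k) • ((X 1 : (MvPolynomial (Fin 3) k)) • pderiv 1) + (w 2 : k) • ((X 2 : (MvPolynomial (Fin 3) k)) • pderiv 2) := by
    apply MvPolynomial.derivation_ext
    intro j
    rw [eul, mkDerivation_X]
    fin_cases j <;> simp [pderiv_X, Pi.single_apply]
  rw [this, Fin.sum_univ_three]
  rfl

lemma eul_monomial (d : Fin 3 →₀ ℕ) (r : k) :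
    eul w (monomial d r) = (Finsupp.weight w d : k) • monomial d r := by
  have h := (isWeightedHomogeneous_monomial w d r rfl).sum_weight_X_mul_pderiv
  rw [eul_apply]
  rw [Nat.cast_smul_eq_nsmul, ← h]
  simp [Nat.cast_smul_eq_nsmul]

lemma eul_homog {f : (MvPolynomial (Fin 3) k)} {n : ℕ} (hf : IsWeightedHomogeneous w f n) : eul w f = (n : k) • f := by
  have h := hf.sum_weight_X_mul_pderiv
  rw [eul_apply, Nat.cast_smul_eq_nsmul, ← h]
  simp [Nat.cast_smul_eq_nsmul]

lemma coeff_eul (f : (MvPolynomial (Fin 3) k)) (d : Fin 3 →₀ ℕ) : coeff d (eul w f) = (Finsupp.weight w d : k) * coeff d f := by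
  induction f using MvPolynomial.induction_on' with
  | monomial e a =>
    rw [eul_monomial, coeff_smul, coeff_monomial]
    split_ifs with h <;> simp [h]
  | add p q hp hq => simp [hp, hq, mul_add]

lemma homog_of_eul {f : (MvPolynomial (Fin 3) k)} {n : ℤ} (h0 : f ≠ 0) (h : eul w f = (n : k) • f) :
    ∃ m : ℕ, (m : ℤ) = n ∧ IsWeightedHomogeneous w f m := by
  have key : ∀ d, coeff d f ≠ 0 → (Finsupp.weight w d : ℤ) = n := by
    intro d hd
    have := congrArg (coeff d) h
    rw [coeff_eul, coeff_smul, smul_eq_mul] at this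
    have := mul_right_cancel₀ hd this
    exact_mod_cast this
  obtain ⟨d, hd⟩ := MvPolynomial.ne_zero_iff.1 h0
  refine ⟨_, key d hd, fun e he => ?_⟩
  have h1 := key d hd
  have h2 := key e he
  omega

variable {D : Derivation k (MvPolynomial (Fin 3) k) (MvPolynomial (Fin 3) k)} 

lemma comp_deriv {m : ℤ} (hD : DerivIsHomogOfDeg (k := k) w D m) (n j : ℕ) (hj : (j : ℤ) = n + m) (f : (MvPolynomial (Fin 3) k)) :
    weightedHomogeneousComponent w j (D f : (MvPolynomial (Fin 3) k)) = D (weightedHomogeneousComponent w n f) := by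
  induction f using MvPolynomial.induction_on' with
  | monomial d a =>
    have hm : IsWeightedHomogeneous w (monomial d a : (MvPolynomial (Fin 3) k)) _ := isWeightedHomogeneous_monomial w d a rfl
    obtain ⟨h1, h2⟩ := hD _ _ hm
    by_cases ht : n = Finsupp.weight w d
    · subst ht
      rw [hm.weightedHomogeneousComponent_same, (h1 j hj).weightedHomogeneousComponent_same]
    · rw [hm.weightedHomogeneousComponent_ne n ht, map_zero]
      rcases lt_or_ge ((Finsupp.weight w d : ℤ) + m) 0 with h | h
      · rw [h2 h, map_zero]
      · obtain ⟨j', hj'⟩ := Int.eq_ofNat_of_zero_le h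
        exact (h1 j' hj'.symm).weightedHomogeneousComponent_ne j (by omega)
  | add p q hp hq => simp [hp, hq]

lemma ker_graded {m : ℤ} (hD : DerivIsHomogOfDeg (k := k) w D m) (f : (MvPolynomial (Fin 3) k)) (n : ℕ) (h : D f = 0) :
    D (weightedHomogeneousComponent w n f) = 0 := by
  rcases lt_or_ge ((n : ℤ) + m) 0 with h' | h'
  · exact (hD n _ (weightedHomogeneousComponent_isWeightedHomogeneous n f)).2 h'
  · obtain ⟨j', hj'⟩ := Int.eq_ofNat_of_zero_le h'
    rw [← comp_deriv hD n j' hj'.symm f, h, map_zero]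

/-- standing assumptions -/
structure Setup (w : Fin 3 → ℕ) (D : Derivation k (MvPolynomial (Fin 3) k) (MvPolynomial (Fin 3) k)) : Prop where
  lnd : IsLND D
  hw : ∀ i, 0 < w i
  ne : D ≠ 0
  gr : ∀ (f : (MvPolynomial (Fin 3) k)) (n : ℕ), D f = 0 → D (weightedHomogeneousComponent w n f) = 0

end GR
end MZ

namespace MZ

section W
variable {k : Type} [Field k] [CharZero k] {w : Fin 3 → ℕ}

lemma nil_add {D : Derivation k (MvPolynomial (Fin 3) k) (MvPolynomial (Fin 3) k)} {a b : (MvPolynomial (Fin 3) k)} (ha : ∃ n, (⇑D)^[n] a = 0) (hb : ∃ n, (⇑D)^[n] b = 0) :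
    ∃ n, (⇑D)^[n] (a + b) = 0 := by
  obtain ⟨m, hm⟩ := ha
  obtain ⟨n, hn⟩ := hb
  refine ⟨m + n, ?_⟩
  rw [iter_add]
  nth_rw 1 [add_comm m n]
  rw [Function.iterate_add_apply, hm, Function.iterate_add_apply, hn, iter_zero, iter_zero, add_zero]

lemma nil_mul {D : Derivation k (MvPolynomial (Fin 3) k) (MvPolynomial (Fin 3) k)} {a b : (MvPolynomial (Fin 3) k)} (ha : ∃ n, (⇑D)^[n] a = 0) (hb : ∃ n, (⇑D)^[n] b = 0) :
    ∃ n, (⇑D)^[n] (a * b) = 0 := by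
  obtain ⟨m, hm⟩ := ha
  obtain ⟨n, hn⟩ := hb
  have hm' : (⇑D)^[m+1] a = 0 := by rw [Function.iterate_succ_apply', hm, map_zero]
  have hn' : (⇑D)^[n+1] b = 0 := by rw [Function.iterate_succ_apply', hn, map_zero]
  refine ⟨m + n, ?_⟩
  rw [iter_mul _ m n a b rfl hm' hn', hm]
  simp

lemma lnd_of_X {D : Derivation k (MvPolynomial (Fin 3) k) (MvPolynomial (Fin 3) k)} (h : ∀ i, ∃ n, (⇑D)^[n] (X i) = 0) : IsLND D := by
  intro b
  induction b using MvPolynomial.induction_on with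
  | C a => exact ⟨1, by simp⟩
  | add p q hp hq => exact nil_add hp hq
  | mul_X p i hp => exact nil_mul hp (h i)

lemma lnd_pderiv (i : Fin 3) : IsLND (pderiv i : Derivation k (MvPolynomial (Fin 3) k) (MvPolynomial (Fin 3) k)) := by
  apply lnd_of_X
  intro j
  refine ⟨2, ?_⟩
  simp only [Function.iterate_succ_apply, Function.iterate_zero_apply, pderiv_X]
  by_cases h : j = i
  · subst h; simp
  · simp [Pi.single_apply, h]

lemma const_of_pderiv {f : (MvPolynomial (Fin 3) k)} (h : ∀ i, pderiv i f = 0) : ∃ c, f = C c := by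
  by_cases h0 : f = 0
  · exact ⟨0, by simp [h0]⟩
  have h1 : eul (fun _ => 1) f = ((0 : ℤ) : k) • f := by
    rw [eul_apply]; simp [h]
  obtain ⟨m, hm, hf⟩ := homog_of_eul h0 h1
  have : m = 0 := by omega
  subst this
  exact homog_zero_const (by simp) hf

lemma WR {u v : (MvPolynomial (Fin 3) k)} (hu : u ≠ 0) (hv : v ≠ 0) (h : ∀ i, pderiv i u * v = u * pderiv i v) :
    ∃ c : k, c ≠ 0 ∧ u = C c * v := by
  obtain ⟨u', v', g, hrel, rfl, rfl⟩ := UniqueFactorizationMonoid.exists_reduced_factors u hu v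
  have hg : g ≠ 0 := left_ne_zero_of_mul hu
  have hu' := right_ne_zero_of_mul hu
  have hv' := right_ne_zero_of_mul hv
  have h' : ∀ i, pderiv i u' * v' = u' * pderiv i v' := by
    intro i
    have := h i
    simp only [Derivation.leibniz, smul_eq_mul] at this
    have h2 : g * g * (pderiv i u' * v') = g * g * (u' * pderiv i v') := by linear_combination this
    exact mul_left_cancel₀ (mul_ne_zero hg hg) h2
  have hvc : ∀ i, pderiv i v' = 0 := fun i =>
    ker_of_dvd_self (lnd_pderiv i) (hrel.symm.dvd_of_dvd_mul_left ⟨pderiv i u', by rw [← h' i]; ring⟩)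
  have huc : ∀ i, pderiv i u' = 0 := fun i =>
    ker_of_dvd_self (lnd_pderiv i) (hrel.dvd_of_dvd_mul_right ⟨pderiv i v', by rw [h' i]⟩)
  obtain ⟨c, rfl⟩ := const_of_pderiv hvc
  obtain ⟨c', rfl⟩ := const_of_pderiv huc
  have hc : c ≠ 0 := by rintro rfl; simp at hv'
  have hc' : c' ≠ 0 := by rintro rfl; simp at hu'
  refine ⟨c' / c, div_ne_zero hc' hc, ?_⟩
  have : (C c' : (MvPolynomial (Fin 3) k)) = C (c'/c) * C c := by rw [← map_mul, div_mul_cancel₀ _ hc]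
  rw [this]; ring

lemma homog_pow {f : (MvPolynomial (Fin 3) k)} {d : ℕ} (h : IsWeightedHomogeneous w f d) (n : ℕ) :
    IsWeightedHomogeneous w (f^n) (n * d) := by simpa using h.pow n

lemma homog_C_mul {f : (MvPolynomial (Fin 3) k)} {d : ℕ} (c : k) (h : IsWeightedHomogeneous w f d) :
    IsWeightedHomogeneous w (C c * f) d := by
  simpa using (isWeightedHomogeneous_C w c).mul h

lemma homog_comb {f g : (MvPolynomial (Fin 3) k)} {d : ℕ} (c e : k) (h : IsWeightedHomogeneous w f d)
    (h' : IsWeightedHomogeneous w g d) : IsWeightedHomogeneous w (C c * f + C e * g) d :=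
  (homog_C_mul c h).add (homog_C_mul e h')

lemma homog_aeval_monomial {ι : Type} [Fintype ι] {v : ι → ℕ} {x : ι → (MvPolynomial (Fin 3) k)}
    (hx : ∀ i, IsWeightedHomogeneous w (x i) (v i)) (d : ι →₀ ℕ) (r : k) :
    IsWeightedHomogeneous w (aeval x (monomial d r)) (Finsupp.weight v d) := by
  rw [aeval_monomial, Finsupp.weight_apply, Finsupp.prod, Finsupp.sum]
  apply homog_C_mul
  apply IsWeightedHomogeneous.prod
  intro i _
  exact (hx i).pow _

lemma comp_aeval {ι : Type} [Fintype ι] {v : ι → ℕ} {x : ι → (MvPolynomial (Fin 3) k)}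
    (hx : ∀ i, IsWeightedHomogeneous w (x i) (v i)) (P : MvPolynomial ι k) (n : ℕ) :
    weightedHomogeneousComponent w n (aeval x P) = aeval x (weightedHomogeneousComponent v n P) := by
  induction P using MvPolynomial.induction_on' with
  | monomial d a =>
    have h1 := homog_aeval_monomial hx d a
    have h2 : IsWeightedHomogeneous v (monomial d a) _ := isWeightedHomogeneous_monomial v d a rfl
    by_cases h : n = Finsupp.weight v d
    · subst h; rw [h1.weightedHomogeneousComponent_same, h2.weightedHomogeneousComponent_same]
    · rw [h1.weightedHomogeneousComponent_ne _ h, h2.weightedHomogeneousComponent_ne _ h, map_zero]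
  | add p q hp hq => simp only [map_add, hp, hq]

lemma unit_homog {u : (MvPolynomial (Fin 3) k)} (hu : IsUnit u) : IsWeightedHomogeneous w u 0 := by
  obtain ⟨v, hv⟩ := hu.exists_right_inv
  have : IsWeightedHomogeneous w (u * v) 0 := by rw [hv]; exact isWeightedHomogeneous_one k w
  obtain ⟨i, j, hi, _, h⟩ := homog_of_mul this (by rw [hv]; exact one_ne_zero)
  have : i = 0 := by omega
  rwa [this] at hi

lemma unit_of_homog_zero (hw : ∀ i, 0 < w i) {f : (MvPolynomial (Fin 3) k)} (h : IsWeightedHomogeneous w f 0) (h0 : f ≠ 0) :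
    IsUnit f := by
  obtain ⟨c, rfl⟩ := homog_zero_const hw h
  have : c ≠ 0 := by rintro rfl; simp at h0
  exact (IsUnit.mk0 c this).map C

/-- homogeneous prime in the kernel -/
structure HP (w : Fin 3 → ℕ) (D : Derivation k (MvPolynomial (Fin 3) k) (MvPolynomial (Fin 3) k)) (p : (MvPolynomial (Fin 3) k)) (d : ℕ) : Prop where
  pr : Prime p
  ker : D p = 0
  hom : IsWeightedHomogeneous w p d

variable {D : Derivation k (MvPolynomial (Fin 3) k) (MvPolynomial (Fin 3) k)} 

lemma HP.pos (S : Setup w D) {p : (MvPolynomial (Fin 3) k)} {d : ℕ} (h : HP w D p d) : 0 < d := by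
  rcases Nat.eq_zero_or_pos d with rfl | hd
  · exact absurd (unit_of_homog_zero S.hw h.hom h.pr.ne_zero) h.pr.not_unit
  · exact hd

lemma exists_HP (S : Setup w D) {a : (MvPolynomial (Fin 3) k)} {n : ℕ} (h0 : a ≠ 0) (ha : D a = 0)
    (hh : IsWeightedHomogeneous w a n) (hn : 0 < n) :
    ∃ p d c, HP w D p d ∧ a = p * c ∧ c ≠ 0 ∧ D c = 0 ∧ d ≤ n ∧ IsWeightedHomogeneous w c (n - d) := by
  have hu : ¬ IsUnit a := fun hu => by
    have := homog_unique h0 (unit_homog (w := w) hu) hh; omega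
  obtain ⟨p, hp, c, rfl⟩ := WfDvdMonoid.exists_irreducible_factor hu h0
  obtain ⟨i, j, hi, hj, hij⟩ := homog_of_mul hh h0
  refine ⟨p, i, c, ⟨hp.prime, ker_of_mul S.lnd h0 ha, hi⟩, rfl, right_ne_zero_of_mul h0,
    ker_of_mul S.lnd (a := c) (b := p) (by rwa [mul_comm]) (by rwa [mul_comm]), by omega, ?_⟩
  have : n - i = j := by omega
  rwa [this]

lemma HP_induct (S : Setup w D) (M : (MvPolynomial (Fin 3) k) → Prop) (h1 : ∀ c : k, c ≠ 0 → M (C c))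
    (h2 : ∀ p d a, HP w D p d → a ≠ 0 → D a = 0 → M a → M (p * a)) {a : (MvPolynomial (Fin 3) k)} {n : ℕ} (h0 : a ≠ 0) (ha : D a = 0)
    (hh : IsWeightedHomogeneous w a n) : M a := by
  induction n using Nat.strong_induction_on generalizing a with
  | _ n ih =>
    rcases Nat.eq_zero_or_pos n with rfl | hn
    · obtain ⟨c, rfl⟩ := homog_zero_const S.hw hh
      exact h1 c (by rintro rfl; simp at h0)
    · obtain ⟨p, d, c, hp, rfl, hc, hDc, hd, hcc⟩ := exists_HP S h0 ha hh hn
      exact h2 p d c hp hc hDc (ih (n - d) (by have := hp.pos S; omega) hc hDc hcc)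

lemma ker_le_of_HP (S : Setup w D) (s : Subalgebra k (MvPolynomial (Fin 3) k)) (h : ∀ p d, HP w D p d → p ∈ s) (r : (MvPolynomial (Fin 3) k))
    (hr : D r = 0) : r ∈ s := by
  apply mem_of_comp (w := w) s
  intro n
  by_cases h0 : weightedHomogeneousComponent w n r = 0
  · rw [h0]; exact zero_mem s
  · exact HP_induct S (fun a => a ∈ s) (fun c _ => s.algebraMap_mem c)
      (fun p d a hp _ _ ha => mul_mem (h p d hp) ha) h0 (S.gr r n hr)
      (weightedHomogeneousComponent_isWeightedHomogeneous n r)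

lemma assoc_const (hw : ∀ i, 0 < w i) {p q : (MvPolynomial (Fin 3) k)} (h : Associated p q) : ∃ c : k, c ≠ 0 ∧ q = C c * p := by
  obtain ⟨u, rfl⟩ := h
  obtain ⟨c, hc⟩ := homog_zero_const hw (unit_homog (w := w) u.isUnit)
  refine ⟨c, ?_, by rw [hc]; ring⟩
  rintro rfl
  apply u.isUnit.ne_zero; rw [hc]; simp

lemma exists_two_HP (S : Setup w D) : ∃ F G d e, HP w D F d ∧ HP w D G e ∧ ¬ Associated F G := by
  by_contra hc
  push Not at hc
  by_cases hex : ∃ F d, HP w D F d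
  · obtain ⟨F, d, hF⟩ := hex
    obtain ⟨r, hr, hr'⟩ := ker_not_single S.lnd S.ne F
    apply hr'
    refine ker_le_of_HP S _ ?_ r hr
    intro p e hp
    obtain ⟨c, _, rfl⟩ := assoc_const S.hw (hc F p d e hF hp)
    exact mul_mem (Subalgebra.algebraMap_mem _ c) (Algebra.subset_adjoin rfl)
  · obtain ⟨r, hr, hr'⟩ := ker_not_single S.lnd S.ne 0
    exact hr' (ker_le_of_HP S _ (fun p d hp => absurd ⟨p, d, hp⟩ hex) r hr)

end W
end MZ

namespace MZ

section L
variable {k : Type} [Field k] [CharZero k] {w : Fin 3 → ℕ} {D : Derivation k (MvPolynomial (Fin 3) k) (MvPolynomial (Fin 3) k)}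

lemma X0_dvd_of {Q : (MvPolynomial (Fin 3) k)} (h : ∀ d, coeff d Q ≠ 0 → d 0 ≠ 0) : (X 0 : (MvPolynomial (Fin 3) k)) ∣ Q := by
  have := (mem_ideal_span_X_image (x := Q) (s := {0})).2 (fun m hm => ⟨0, rfl, h m (by simpa using hm)⟩)
  rw [Set.image_singleton, Ideal.mem_span_singleton] at this
  exact this

/-- dehomogenisation step -/
lemma dehom {R : Type*} [Field R] [Algebra k R] {d N n : ℕ} (hN : 0 < N) {Q : (MvPolynomial (Fin 3) k)}
    (hQ : IsWeightedHomogeneous ![d, N, N] Q n) (hX : ¬ (X 0 : (MvPolynomial (Fin 3) k)) ∣ Q) (a b : R) (hb : b ≠ 0)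
    (h0 : aeval ![0, a, b] Q = 0) : IsAlgebraic k (a / b) := by
  have hex : ∃ d, coeff d Q ≠ 0 ∧ d 0 = 0 := by
    by_contra hc; push Not at hc; exact hX (X0_dvd_of hc)
  have hwt : ∀ e, coeff e Q ≠ 0 → e 0 = 0 → N * (e 1 + e 2) = n := by
    intro e he h0
    have := hQ he
    rw [Finsupp.weight_apply, Finsupp.sum_fintype _ _ (by simp), Fin.sum_univ_three] at this
    simp [h0] at this
    rw [← this]; ring
  obtain ⟨e₀, he₀, he₀'⟩ := hex
  refine ⟨aeval ![0, Polynomial.X, 1] Q, ?_, ?_⟩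
  · intro hz
    apply he₀
    have := congrArg (fun p => Polynomial.coeff p (e₀ 1)) hz
    simp only [aeval_def, eval₂_eq', Fin.prod_univ_three, Polynomial.finsetSum_coeff, Polynomial.coeff_zero] at this
    rw [Finset.sum_eq_single e₀] at this
    · simpa [he₀'] using this
    · intro e he hne
      have he' : coeff e Q ≠ 0 := by simpa using he
      by_cases h00 : e 0 = 0
      · have h1 := hwt e he' h00
        have h2 := hwt e₀ he₀ he₀'
        have h3 : e 1 + e 2 = e₀ 1 + e₀ 2 := Nat.eq_of_mul_eq_mul_left hN (by omega)
        have : e₀ 1 ≠ e 1 := by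
          intro h4
          apply hne
          ext i; fin_cases i
          · simp [h00, he₀']
          · simp [h4]
          · simp; omega
        simp [h00, Polynomial.coeff_X_pow, this]
      · simp [h00]
    · intro h; simp at h; simp [h]
  · obtain ⟨M, hM⟩ : ∃ M, ∀ e, coeff e Q ≠ 0 → e 0 = 0 → e 1 + e 2 = M := by
      refine ⟨e₀ 1 + e₀ 2, fun e he h0 => ?_⟩
      have h1 := hwt e he h0
      have h2 := hwt e₀ he₀ he₀'
      exact Nat.eq_of_mul_eq_mul_left hN (by omega)
    have key : aeval ![0, a, b] Q = b ^ M * Polynomial.aeval (a/b) (aeval ![0, Polynomial.X, 1] Q : Polynomial k) := by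
      simp only [aeval_def, eval₂_eq', Fin.prod_univ_three, map_sum, Finset.mul_sum]
      apply Finset.sum_congr rfl
      intro e he
      have he' : coeff e Q ≠ 0 := by simpa using he
      by_cases h00 : e 0 = 0
      · rw [← hM e he' h00]
        simp [h00, Polynomial.eval₂_mul, Polynomial.eval₂_pow, div_pow, pow_add]
        field_simp
      · simp [h00, Polynomial.eval₂_mul]
    rw [key] at h0
    exact (mul_eq_zero.1 h0).resolve_left (pow_ne_zero _ hb)

lemma DEP [IsAlgClosed k] (S : Setup w D) {p a b : (MvPolynomial (Fin 3) k)} {d N : ℕ} (hp : HP w D p d) (hN : 0 < N)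
    (ha : IsWeightedHomogeneous w a N) (hb : IsWeightedHomogeneous w b N) (hDa : D a = 0) (hDb : D b = 0) :
    ∃ c e : k, (c ≠ 0 ∨ e ≠ 0) ∧ p ∣ C c * a + C e * b := by
  by_cases hpb : p ∣ b
  · exact ⟨0, 1, by simp, by simpa using hpb⟩
  have hdep := ker_algdep S.lnd S.ne ![p, a, b] (by intro i; fin_cases i <;> simp [hp.ker, hDa, hDb])
  rw [algebraicIndependent_iff] at hdep
  push Not at hdep
  obtain ⟨P, hP, hP0⟩ := hdep
  have hx : ∀ i, IsWeightedHomogeneous w ((![p, a, b] : Fin 3 → (MvPolynomial (Fin 3) k)) i) ((![d, N, N] : Fin 3 → ℕ) i) := by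
    intro i; fin_cases i
    · exact hp.hom
    · exact ha
    · exact hb
  obtain ⟨n, hn⟩ : ∃ n, weightedHomogeneousComponent ![d, N, N] n P ≠ 0 := by
    by_contra hc; push Not at hc
    apply hP0
    have := mem_of_comp (w := ![d,N,N]) (⊥ : Submodule k (MvPolynomial (Fin 3) k)) P (by intro n; rw [hc n]; exact zero_mem _)
    simpa using this
  have hQ0 : aeval ![p, a, b] (weightedHomogeneousComponent ![d, N, N] n P) = 0 := by
    rw [← comp_aeval hx, hP, map_zero]
  have hQh := weightedHomogeneousComponent_isWeightedHomogeneous (w := ![d, N, N]) n P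
  generalize weightedHomogeneousComponent ![d, N, N] n P = Q at *
  obtain ⟨m, Q', hXQ, rfl⟩ := WfDvdMonoid.max_power_factor hn (X_prime (i := (0 : Fin 3)) (R := k)).irreducible
  obtain ⟨_, n', _, hQ', _⟩ := homog_of_mul hQh hn
  have hQ'0 : aeval ![p, a, b] Q' = 0 := by
    rw [map_mul, map_pow, aeval_X] at hQ0
    exact (mul_eq_zero.1 hQ0).resolve_left (pow_ne_zero _ hp.pr.ne_zero)
  let I : Ideal (MvPolynomial (Fin 3) k) := Ideal.span {p}
  have hI : I.IsPrime := (Ideal.span_singleton_prime hp.pr.ne_zero).2 hp.pr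
  let R := FractionRing ((MvPolynomial (Fin 3) k) ⧸ I)
  let f : (MvPolynomial (Fin 3) k) →ₐ[k] R := (IsScalarTower.toAlgHom k ((MvPolynomial (Fin 3) k) ⧸ I) R).comp (Ideal.Quotient.mkₐ k I)
  have hf : ∀ x, f x = 0 ↔ p ∣ x := by
    intro x
    have : f x = algebraMap ((MvPolynomial (Fin 3) k) ⧸ I) R (Ideal.Quotient.mk I x) := rfl
    rw [this, map_eq_zero_iff _ (IsFractionRing.injective ((MvPolynomial (Fin 3) k) ⧸ I) R), Ideal.Quotient.eq_zero_iff_mem,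
      Ideal.mem_span_singleton]
  have hfQ : aeval ![0, f a, f b] Q' = 0 := by
    have h1 : f (aeval ![p, a, b] Q') = 0 := by rw [hQ'0, map_zero]
    rw [comp_aeval_apply] at h1
    have hv : (![0, f a, f b] : Fin 3 → R) = fun i => f ((![p, a, b] : Fin 3 → (MvPolynomial (Fin 3) k)) i) := by
     ext i; fin_cases i
     · exact ((hf p).2 dvd_rfl).symm
     · rfl
     · rfl
    rw [hv, h1]
  have hfb : f b ≠ 0 := fun h => hpb ((hf b).1 h)
  have halg := dehom hN hQ' hXQ (f a) (f b) hfb hfQ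
  obtain ⟨c, hc⟩ : ∃ c : k, algebraMap k R c = f a / f b := by
    have h1 := IsAlgClosed.degree_eq_one_of_irreducible k (minpoly.irreducible halg.isIntegral)
    exact minpoly.mem_range_of_degree_eq_one k _ h1
  refine ⟨1, -c, by simp, ?_⟩
  rw [← hf, map_add, map_mul, map_mul]
  have hC : ∀ x : k, f (C x) = algebraMap k R x := fun x => f.commutes x
  rw [hC, hC, map_neg, hc]
  rw [map_one, one_mul, neg_mul, div_mul_cancel₀ _ hfb, add_neg_cancel]

/-- restriction to a line -/
def lineHom (x : Fin 3 → k) (i : Fin 3) : (MvPolynomial (Fin 3) k) →ₐ[k] Polynomial k :=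
  aeval (fun j => Polynomial.C (x j) + if j = i then Polynomial.X else 0)

lemma lineHom_deriv (x : Fin 3 → k) (i : Fin 3) (f : (MvPolynomial (Fin 3) k)) :
    Polynomial.derivative (lineHom x i f) = lineHom x i (pderiv i f) := by
  induction f using MvPolynomial.induction_on with
  | C a => simp [lineHom]
  | add p q hp hq => simp [hp, hq]
  | mul_X p j hp =>
    rw [map_mul, Polynomial.derivative_mul, hp, Derivation.leibniz, map_add, smul_eq_mul, smul_eq_mul,
      map_mul, map_mul, pderiv_X]
    have h1 : lineHom x i (X j) = Polynomial.C (x j) + if j = i then Polynomial.X else 0 := by simp [lineHom]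
    rw [h1]
    by_cases h : j = i
    · subst h; simp; ring
    · simp [h, Pi.single_apply]; ring

lemma lineHom_eval (x : Fin 3 → k) (i : Fin 3) (f : (MvPolynomial (Fin 3) k)) :
    (lineHom x i f).eval 0 = eval x f := by
  induction f using MvPolynomial.induction_on with
  | C a => simp [lineHom]
  | add p q hp hq => simp [hp, hq]
  | mul_X p j hp =>
    rw [map_mul, Polynomial.eval_mul, hp, map_mul]
    congr 1
    by_cases h : j = i <;> simp [lineHom, h]

lemma exists_line [IsAlgClosed k] (S : Setup w D) : ∃ φ : (MvPolynomial (Fin 3) k) →ₐ[k] Polynomial k,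
    ∀ (a : (MvPolynomial (Fin 3) k)) (n : ℕ), D a = 0 → IsWeightedHomogeneous w a n → φ a = 0 → a = 0 := by
  obtain ⟨F, G, d, e, hF, hG, hna⟩ := exists_two_HP S
  have hd := hF.pos S
  have he := hG.pos S
  have hu0 : F ^ e ≠ 0 := pow_ne_zero _ hF.pr.ne_zero
  have hv0 : G ^ d ≠ 0 := pow_ne_zero _ hG.pr.ne_zero
  obtain ⟨i, hi⟩ : ∃ i, pderiv i (F^e) * G^d - F^e * pderiv i (G^d) ≠ 0 := by
    by_contra hc
    push Not at hc
    obtain ⟨c, hc, h⟩ := WR hu0 hv0 (fun i => sub_eq_zero.1 (hc i))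
    apply hna
    have : G ∣ F ^ e := by rw [h]; exact dvd_mul_of_dvd_right (dvd_pow_self _ hd.ne') _
    exact (hG.pr.associated_of_dvd hF.pr (hG.pr.dvd_of_dvd_pow this)).symm
  have hi2 : ∃ x, eval x (pderiv i (F^e) * G^d - F^e * pderiv i (G^d)) ≠ 0 := by
    by_contra hc
    push Not at hc
    exact hi (MvPolynomial.funext (fun x => by rw [hc x]; simp))
  obtain ⟨x, hx⟩ := hi2
  refine ⟨lineHom x i, ?_⟩
  have hprime : ∀ p m, HP w D p m → lineHom x i p ≠ 0 := by
    intro p m hp h0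
    obtain ⟨c, c', hcc, q, hq⟩ := DEP S hp (N := e * d) (by positivity) (homog_pow hF.hom e)
      (by rw [mul_comm e d]; exact homog_pow hG.hom d) (by simp [hF.ker]) (by simp [hG.ker])
    have h1 : Polynomial.C c * lineHom x i (F^e) + Polynomial.C c' * lineHom x i (G^d) = 0 := by
      have := congrArg (lineHom x i) hq
      rw [map_mul, h0, zero_mul, map_add, map_mul, map_mul] at this
      have hC : ∀ y : k, lineHom x i (C y) = Polynomial.C y := fun y => by simp [lineHom]
      rw [hC, hC] at this
      exact this
    have h2 := congrArg Polynomial.derivative h1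
    simp only [Polynomial.derivative_add, Polynomial.derivative_C_mul, lineHom_deriv, Polynomial.derivative_zero] at h2
    have h1' := congrArg (Polynomial.eval 0) h1
    have h2' := congrArg (Polynomial.eval 0) h2
    simp only [Polynomial.eval_add, Polynomial.eval_mul, Polynomial.eval_C, lineHom_eval, Polynomial.eval_zero] at h1' h2'
    simp only [map_sub, map_mul] at hx
    rcases hcc with hc | hc
    · apply hc
      have : c * (eval x (pderiv i (F^e)) * eval x (G^d) - eval x (F^e) * eval x (pderiv i (G^d))) = 0 := by
        linear_combination (eval x (G^d)) * h2' - eval x (pderiv i (G^d)) * h1'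
      exact (mul_eq_zero.1 this).resolve_right hx
    · apply hc
      have : c' * (eval x (pderiv i (F^e)) * eval x (G^d) - eval x (F^e) * eval x (pderiv i (G^d))) = 0 := by
        linear_combination (-eval x (F^e)) * h2' + eval x (pderiv i (F^e)) * h1'
      exact (mul_eq_zero.1 this).resolve_right hx
  intro a n hDa ha h0
  by_contra hne
  refine HP_induct S (fun a => lineHom x i a ≠ 0) ?_ ?_ hne hDa ha h0
  · intro c hc; simpa [lineHom] using hc
  · intro p m a hp _ _ ha; rw [map_mul]; exact mul_ne_zero (hprime p m hp) ha

end L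
end MZ

namespace MZ

section Lu
variable {k : Type} [Field k] [CharZero k] {w : Fin 3 → ℕ} {D : Derivation k (MvPolynomial (Fin 3) k) (MvPolynomial (Fin 3) k)}

lemma exists_inj [IsAlgClosed k] (S : Setup w D) : ∃ j : (MvPolynomial (Fin 3) k) →ₐ[k] RatFunc k,
    ∀ (a : (MvPolynomial (Fin 3) k)) (n : ℕ), D a = 0 → IsWeightedHomogeneous w a n → j a = 0 → a = 0 := by
  obtain ⟨φ, h⟩ := exists_line S
  refine ⟨(IsScalarTower.toAlgHom k (Polynomial k) (RatFunc k)).comp φ, ?_⟩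
  intro a n h1 h2 h3
  apply h a n h1 h2
  have h4 : algebraMap (Polynomial k) (RatFunc k) (φ a) = 0 := h3
  exact (map_eq_zero_iff _ (IsFractionRing.injective (Polynomial k) (RatFunc k))).1 h4

/-- degree-zero field of fractions of the kernel -/
def Lfield (w : Fin 3 → ℕ) (D : Derivation k (MvPolynomial (Fin 3) k) (MvPolynomial (Fin 3) k)) (j : (MvPolynomial (Fin 3) k) →ₐ[k] RatFunc k)
    (hj : ∀ (a : (MvPolynomial (Fin 3) k)) (n : ℕ), D a = 0 → IsWeightedHomogeneous w a n → j a = 0 → a = 0) :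
    IntermediateField k (RatFunc k) where
  carrier := {x | ∃ a b n, D a = 0 ∧ D b = 0 ∧ IsWeightedHomogeneous w a n ∧
    IsWeightedHomogeneous w b n ∧ b ≠ 0 ∧ x = j a / j b}
  mul_mem' := by
    rintro _ _ ⟨a, b, n, ha, hb, hha, hhb, hb0, rfl⟩ ⟨a', b', n', ha', hb', hha', hhb', hb0', rfl⟩
    refine ⟨a * a', b * b', n + n', by simp [ha, ha'], by simp [hb, hb'], hha.mul hha', hhb.mul hhb',
      mul_ne_zero hb0 hb0', ?_⟩
    rw [map_mul, map_mul, div_mul_div_comm]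
  add_mem' := by
    rintro _ _ ⟨a, b, n, ha, hb, hha, hhb, hb0, rfl⟩ ⟨a', b', n', ha', hb', hha', hhb', hb0', rfl⟩
    refine ⟨a * b' + b * a', b * b', n + n', by simp [ha, ha', hb, hb'], by simp [hb, hb'],
      (hha.mul hhb').add (hhb.mul hha'), hhb.mul hhb',
      mul_ne_zero hb0 hb0', ?_⟩
    rw [map_add, map_mul, map_mul, map_mul, div_add_div _ _ (fun h => hb0 (hj b n hb hhb h))
      (fun h => hb0' (hj b' n' hb' hhb' h))]
  algebraMap_mem' := by
    intro c
    refine ⟨C c, 1, 0, by simp, by simp, isWeightedHomogeneous_C w c, isWeightedHomogeneous_one k w,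
      one_ne_zero, ?_⟩
    rw [map_one, div_one]
    exact (j.commutes c).symm
  inv_mem' := by
    rintro _ ⟨a, b, n, ha, hb, hha, hhb, hb0, rfl⟩
    by_cases h : a = 0
    · subst h
      refine ⟨0, b, n, by simp, hb, hha, hhb, hb0, by simp⟩
    · exact ⟨b, a, n, hb, ha, hhb, hha, h, by rw [inv_div]⟩

lemma jC (j : (MvPolynomial (Fin 3) k) →ₐ[k] RatFunc k) (c : k) : j (C c) = algebraMap k (RatFunc k) c := j.commutes c

/-- linear form in the pencil -/
def lf (a b : (MvPolynomial (Fin 3) k)) (x : k × k) : (MvPolynomial (Fin 3) k) := C x.1 * a + C x.2 * b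

lemma hom_poly [IsAlgClosed k] (j : (MvPolynomial (Fin 3) k) →ₐ[k] RatFunc k) {a b : (MvPolynomial (Fin 3) k)} {σ : RatFunc k} (hb : j b ≠ 0)
    (hσ : σ = j a / j b) (P : Polynomial k) (hP : P ≠ 0) (M : ℕ) (hM : P.natDegree ≤ M) :
    ∃ (s : Multiset (k × k)) (c : k), (∀ x ∈ s, x ≠ 0) ∧ s.card = M ∧ c ≠ 0 ∧
      (j b)^M * Polynomial.aeval σ P = j (C c * (s.map (lf a b)).prod) := by
  have hsp := IsAlgClosed.splits P
  have hcard : P.roots.card = P.natDegree := hsp.natDegree_eq_card_roots.symm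
  refine ⟨P.roots.map (fun r => (1, -r)) + Multiset.replicate (M - P.natDegree) (0, 1), P.leadingCoeff, ?_, ?_,
    by simpa using hP, ?_⟩
  · intro x hx
    rw [Multiset.mem_add, Multiset.mem_map] at hx
    rcases hx with ⟨r, _, rfl⟩ | hx
    · simp
    · rw [Multiset.eq_of_mem_replicate hx]; simp
  · simp [hcard]; omega
  · have key : ∀ s : Multiset k, (j b)^(s.card) * Polynomial.aeval σ ((s.map (fun r => Polynomial.X - Polynomial.C r)).prod) =
        j ((s.map (fun r => lf a b (1, -r))).prod) := by
      intro s
      induction s using Multiset.induction_on with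
      | empty => simp
      | cons r s ih =>
        simp only [Multiset.map_cons, Multiset.prod_cons, map_mul, Multiset.card_cons]
        rw [← ih]
        have : j b * Polynomial.aeval σ (Polynomial.X - Polynomial.C r) = j (lf a b (1, -r)) := by
          rw [lf, hσ]
          simp only [map_add, map_mul, map_one, one_mul, map_neg, jC, map_sub, Polynomial.aeval_X, Polynomial.aeval_C]
          field_simp
          ring
        rw [← this]; ring
    have h1 : Polynomial.aeval σ P = algebraMap k _ P.leadingCoeff *
        Polynomial.aeval σ ((P.roots.map (fun r => Polynomial.X - Polynomial.C r)).prod) := by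
      conv_lhs => rw [hsp.eq_prod_roots]
      rw [map_mul, Polynomial.aeval_C]
    have h2 : (j b)^M = (j b)^(M - P.natDegree) * (j b)^(P.roots.card) := by
      rw [hcard, ← pow_add]; congr 1; omega
    have h3 : lf a b (0, 1) = b := by simp [lf]
    rw [h1, h2, Multiset.map_add, Multiset.prod_add, map_mul, map_mul, jC, Multiset.map_map,
      Multiset.map_replicate, Multiset.prod_replicate, h3, map_pow]
    have := key P.roots
    simp only [Function.comp_def]
    rw [← this]
    ring

lemma homog_lf {a b : (MvPolynomial (Fin 3) k)} {N : ℕ} (ha : IsWeightedHomogeneous w a N) (hb : IsWeightedHomogeneous w b N)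
    (x : k × k) : IsWeightedHomogeneous w (lf a b x) N := homog_comb _ _ ha hb

lemma homog_lf_prod {a b : (MvPolynomial (Fin 3) k)} {N : ℕ} (ha : IsWeightedHomogeneous w a N) (hb : IsWeightedHomogeneous w b N)
    (s : Multiset (k × k)) : IsWeightedHomogeneous w ((s.map (lf a b)).prod) (s.card * N) := by
  induction s using Multiset.induction_on with
  | empty => simpa using isWeightedHomogeneous_one k w
  | cons r s ih =>
    simp only [Multiset.map_cons, Multiset.prod_cons, Multiset.card_cons]
    have := (homog_lf ha hb r).mul ih
    convert this using 1; ring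

lemma ker_lf {a b : (MvPolynomial (Fin 3) k)} (ha : D a = 0) (hb : D b = 0) (x : k × k) : D (lf a b x) = 0 := by
  rw [lf, map_add, ← smul_eq_C_mul, ← smul_eq_C_mul, Derivation.map_smul, Derivation.map_smul, ha, hb]; simp

lemma ker_lf_prod {a b : (MvPolynomial (Fin 3) k)} (ha : D a = 0) (hb : D b = 0) (s : Multiset (k × k)) :
    D ((s.map (lf a b)).prod) = 0 := by
  have : (s.map (lf a b)).prod ∈ kerA D := by
    apply Subalgebra.multiset_prod_mem
    intro x hx
    obtain ⟨y, _, rfl⟩ := Multiset.mem_map.1 hx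
    exact ker_lf ha hb y
  exact this

/-- the pencil generating the field -/
structure Pencil (w : Fin 3 → ℕ) (D : Derivation k (MvPolynomial (Fin 3) k) (MvPolynomial (Fin 3) k)) (a b : (MvPolynomial (Fin 3) k)) (N : ℕ) : Prop where
  pos : 0 < N
  ha : IsWeightedHomogeneous w a N
  hb : IsWeightedHomogeneous w b N
  ka : D a = 0
  kb : D b = 0
  rel : IsRelPrime a b
  ind : ∀ x, lf a b x = 0 → x = 0
  rep : ∀ (a1 b1 : (MvPolynomial (Fin 3) k)) (n : ℕ), D a1 = 0 → D b1 = 0 → IsWeightedHomogeneous w a1 n →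
    IsWeightedHomogeneous w b1 n → a1 ≠ 0 → b1 ≠ 0 → ∃ (s t : Multiset (k × k)) (c c' : k), (∀ x ∈ s, x ≠ 0) ∧
      (∀ x ∈ t, x ≠ 0) ∧ c ≠ 0 ∧ c' ≠ 0 ∧
      a1 * (C c * (s.map (lf a b)).prod) = b1 * (C c' * (t.map (lf a b)).prod)

lemma exists_pencil [IsAlgClosed k] (S : Setup w D) : ∃ a b N, Pencil w D a b N := by
  obtain ⟨j, hj⟩ := exists_inj S
  let E := Lfield w D j hj
  have hmemE : ∀ x, x ∈ E ↔ ∃ a b n, D a = 0 ∧ D b = 0 ∧ IsWeightedHomogeneous w a n ∧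
    IsWeightedHomogeneous w b n ∧ b ≠ 0 ∧ x = j a / j b := fun x => Iff.rfl
  have hE : E ≠ ⊥ := by
    intro hbot
    obtain ⟨F, G, d, e, hF, hG, hna⟩ := exists_two_HP S
    have hd := hF.pos S
    have hkF : D (F^e) = 0 := by simp [hF.ker]
    have hkG : D (G^d) = 0 := by simp [hG.ker]
    have hhF := homog_pow hF.hom e
    have hhG : IsWeightedHomogeneous w (G^d) (e * d) := by rw [mul_comm]; exact homog_pow hG.hom d
    have hG0 : G^d ≠ 0 := pow_ne_zero _ hG.pr.ne_zero
    have hm : j (F^e) / j (G^d) ∈ E := (hmemE _).2 ⟨_, _, _, hkF, hkG, hhF, hhG, hG0, rfl⟩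
    rw [hbot, IntermediateField.mem_bot] at hm
    obtain ⟨c, hc⟩ := hm
    have hjG : j (G^d) ≠ 0 := fun h => hG0 (hj _ _ hkG hhG h)
    have h0 : j (C 1 * F^e + C (-c) * G^d) = 0 := by
      simp only [map_add, map_mul, jC, map_neg, map_one, one_mul, hc]
      field_simp; simp
    have h1 := hj _ _ (ker_lf hkF hkG (1, -c)) (homog_comb _ _ hhF hhG) h0
    apply hna
    have : G ∣ F ^ e := by
      have h2 : F ^ e = C c * G^d := by
        simp only [lf, map_one, one_mul, map_neg] at h1
        linear_combination h1
      rw [h2]; exact dvd_mul_of_dvd_right (dvd_pow_self _ hd.ne') _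
    exact (hG.pr.associated_of_dvd hF.pr (hG.pr.dvd_of_dvd_pow this)).symm
  have hgen := RatFunc.Luroth.eq_adjoin_generator (E := E)
  have hspec := RatFunc.Luroth.generator_spec hE
  have hne := RatFunc.Luroth.generator_ne_zero hE
  have hmem : RatFunc.Luroth.generator E ∈ E := RatFunc.Luroth.generator_mem
  generalize RatFunc.Luroth.generator E = σ at *
  obtain ⟨a0, b0, n0, ka0, kb0, ha0, hb0, hb00, hσ0⟩ := (hmemE _).1 hmem
  have ha00 : a0 ≠ 0 := by rintro rfl; simp at hσ0; exact hne hσ0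
  obtain ⟨a, b, g, hrel, rfl, rfl⟩ := UniqueFactorizationMonoid.exists_reduced_factors a0 ha00 b0
  obtain ⟨i1, N, hg1, ha, hN1⟩ := homog_of_mul ha0 ha00
  obtain ⟨i2, N2, hg2, hb, hN2⟩ := homog_of_mul hb0 hb00
  have hi : i1 = i2 := homog_unique (left_ne_zero_of_mul ha00) hg1 hg2
  have hNN : N2 = N := by omega
  subst hNN
  have kg : D g = 0 := ker_of_mul S.lnd ha00 ka0
  have ka : D a = 0 := ker_of_dvd S.lnd ha00 ka0 (dvd_mul_left _ _)
  have kb : D b = 0 := ker_of_dvd S.lnd hb00 kb0 (dvd_mul_left _ _)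
  have hane := right_ne_zero_of_mul ha00
  have hbne := right_ne_zero_of_mul hb00
  have hjb : j b ≠ 0 := fun h => hbne (hj _ _ kb hb h)
  have hjg : j g ≠ 0 := fun h => (left_ne_zero_of_mul ha00) (hj _ _ kg hg1 h)
  have hσ : σ = j a / j b := by
    rw [hσ0, map_mul, map_mul, mul_div_mul_left _ _ hjg]
  have hind : ∀ x, lf a b x = 0 → x = 0 := by
    rintro ⟨α, β⟩ hx
    simp only [lf] at hx
    by_cases hα : α = 0
    · subst hα
      simp [hbne] at hx
      simp [hx]
    · exfalso
      apply hspec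
      refine ⟨-β/α, ?_⟩
      have := congrArg j hx
      simp only [map_add, map_mul, jC, map_zero] at this
      have hα' : algebraMap k (RatFunc k) α ≠ 0 := by simpa using hα
      rw [hσ, map_div₀, map_neg]
      rw [div_eq_div_iff hα' hjb]
      linear_combination -this
  refine ⟨a, b, N2, ⟨?_, ha, hb, ka, kb, hrel, hind, ?_⟩⟩
  · rcases Nat.eq_zero_or_pos N2 with rfl | h
    · exfalso
      obtain ⟨c, rfl⟩ := homog_zero_const S.hw ha
      obtain ⟨c', rfl⟩ := homog_zero_const S.hw hb
      have := hind (c', -c) (by simp [lf, mul_comm])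
      simp at this
      rw [this.1] at hbne; simp at hbne
    · exact h
  · intro a1 b1 n ka1 kb1 ha1 hb1 ha1n hb1n
    have hja1 : j a1 ≠ 0 := fun h => ha1n (hj _ _ ka1 ha1 h)
    have hjb1 : j b1 ≠ 0 := fun h => hb1n (hj _ _ kb1 hb1 h)
    have hm1 : j a1 / j b1 ∈ E := (hmemE _).2 ⟨a1, b1, n, ka1, kb1, ha1, hb1, hb1n, rfl⟩
    rw [hgen, IntermediateField.mem_adjoin_simple_iff] at hm1
    obtain ⟨P, Q, hPQ⟩ := hm1
    have hne : j a1 / j b1 ≠ 0 := div_ne_zero hja1 hjb1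
    have hPs : Polynomial.aeval σ P ≠ 0 := by intro h; rw [hPQ, h, zero_div] at hne; exact hne rfl
    have hQs : Polynomial.aeval σ Q ≠ 0 := by intro h; rw [hPQ, h, div_zero] at hne; exact hne rfl
    have hP0 : P ≠ 0 := by rintro rfl; simp at hPs
    have hQ0 : Q ≠ 0 := by rintro rfl; simp at hQs
    obtain ⟨s, c, hs, hsc, hc, hsP⟩ := hom_poly j hjb hσ Q hQ0 (max P.natDegree Q.natDegree) (le_max_right _ _)
    obtain ⟨t, c', ht, htc, hc', htP⟩ := hom_poly j hjb hσ P hP0 (max P.natDegree Q.natDegree) (le_max_left _ _)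
    refine ⟨s, t, c, c', hs, ht, hc, hc', ?_⟩
    have hcard : s.card = t.card := by rw [hsc, htc]
    have hk : ∀ (x : (MvPolynomial (Fin 3) k)) (c : k) (s : Multiset (k × k)), D x = 0 → D (x * (C c * (s.map (lf a b)).prod)) = 0 := by
      intro x c s hx
      simp [hx, ker_lf_prod ka kb s, ← smul_eq_C_mul]
    have h1 : D (a1 * (C c * (s.map (lf a b)).prod) - b1 * (C c' * (t.map (lf a b)).prod)) = 0 := by
      rw [map_sub, hk _ _ _ ka1, hk _ _ _ kb1, sub_zero]
    have h2 : IsWeightedHomogeneous w (a1 * (C c * (s.map (lf a b)).prod) - b1 * (C c' * (t.map (lf a b)).prod))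
        (n + s.card * N2) := by
      have h3 := ha1.mul (homog_C_mul c (homog_lf_prod ha hb s))
      have h4 := hb1.mul (homog_C_mul c' (homog_lf_prod ha hb t))
      rw [← hcard] at h4
      exact (weightedHomogeneousSubmodule k w _).sub_mem h3 h4
    have h3 := hj _ _ h1 h2 (by
      rw [map_sub, map_mul j a1, map_mul j b1, ← hsP, ← htP]
      rw [div_eq_div_iff hjb1 hQs] at hPQ
      linear_combination (j b ^ max P.natDegree Q.natDegree) * hPQ)
    exact sub_eq_zero.1 h3

end Lu
end MZ

namespace MZ

section Pen
variable {k : Type} [Field k] [CharZero k] {w : Fin 3 → ℕ} {D : Derivation k (MvPolynomial (Fin 3) k) (MvPolynomial (Fin 3) k)}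
variable {a b : (MvPolynomial (Fin 3) k)} {N : ℕ}

lemma not_dvd_C {p : (MvPolynomial (Fin 3) k)} (hp : Prime p) {c : k} (hc : c ≠ 0) : ¬ p ∣ C c := fun h =>
  hp.not_unit (isUnit_of_dvd_unit h ((isUnit_iff_ne_zero.2 hc).map C))

lemma pen_det (Q : Pencil w D a b N) {p : (MvPolynomial (Fin 3) k)} (hp : Prime p) {x y : k × k}
    (hx : p ∣ lf a b x) (hy : p ∣ lf a b y) : x.1 * y.2 = x.2 * y.1 := by
  by_contra hne
  have hne' : x.1 * y.2 - x.2 * y.1 ≠ 0 := sub_ne_zero.2 hne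
  have h1 : p ∣ C (x.1 * y.2 - x.2 * y.1) * b := by
    have : C (x.1 * y.2 - x.2 * y.1) * b = C x.1 * lf a b y - C y.1 * lf a b x := by
      simp only [lf, map_sub, map_mul]; ring
    rw [this]; exact dvd_sub (hy.mul_left _) (hx.mul_left _)
  have h2 : p ∣ C (x.1 * y.2 - x.2 * y.1) * a := by
    have : C (x.1 * y.2 - x.2 * y.1) * a = C y.2 * lf a b x - C x.2 * lf a b y := by
      simp only [lf, map_sub, map_mul]; ring
    rw [this]; exact dvd_sub (hx.mul_left _) (hy.mul_left _)
  have hb := (hp.dvd_or_dvd h1).resolve_left (not_dvd_C hp hne')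
  have ha := (hp.dvd_or_dvd h2).resolve_left (not_dvd_C hp hne')
  exact hp.not_unit (Q.rel ha hb)

lemma pair_prop {x y : k × k} (hx : x ≠ 0) (hy : y ≠ 0) (h : x.1 * y.2 = x.2 * y.1) :
    ∃ μ : k, μ ≠ 0 ∧ y = (μ * x.1, μ * x.2) := by
  obtain ⟨x1, x2⟩ := x
  obtain ⟨y1, y2⟩ := y
  simp only at h
  by_cases h1 : x1 = 0
  · subst h1
    have h2 : x2 ≠ 0 := by intro h; subst h; exact hx rfl
    have h3 : y1 = 0 := by simpa [h2] using h.symm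
    subst h3
    have h4 : y2 ≠ 0 := by intro h; subst h; exact hy rfl
    exact ⟨y2 / x2, div_ne_zero h4 h2, by simp [h2]⟩
  · have h3 : y2 = y1 / x1 * x2 := by field_simp; linear_combination h
    have h4 : y1 ≠ 0 := by rintro rfl; simp at h3; subst h3; exact hy rfl
    exact ⟨y1 / x1, div_ne_zero h4 h1, by rw [← h3]; simp [h1]⟩

lemma lf_smul (μ : k) (x : k × k) : lf a b (μ * x.1, μ * x.2) = C μ * lf a b x := by
  simp only [lf, map_mul]; ring

lemma multiset_split (Q : Pencil w D a b N) {x : k × k} (hx : x ≠ 0) (s : Multiset (k × k))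
    (hs : ∀ y ∈ s, y ≠ 0) : ∃ (i : ℕ) (v : (MvPolynomial (Fin 3) k)), (s.map (lf a b)).prod = lf a b x ^ i * v ∧
      ∀ p, Prime p → p ∣ lf a b x → ¬ p ∣ v := by
  induction s using Multiset.induction_on with
  | empty => exact ⟨0, 1, by simp, fun p hp _ h => hp.not_unit (isUnit_of_dvd_one h)⟩
  | cons y s ih =>
    obtain ⟨i, v, h1, h2⟩ := ih (fun z hz => hs z (Multiset.mem_cons_of_mem hz))
    have hy := hs y (Multiset.mem_cons_self y s)
    rw [Multiset.map_cons, Multiset.prod_cons, h1]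
    by_cases hd : x.1 * y.2 = x.2 * y.1
    · obtain ⟨μ, hμ, rfl⟩ := pair_prop hx hy hd
      refine ⟨i + 1, C μ * v, by rw [lf_smul]; ring, ?_⟩
      intro p hp hpx h
      rcases hp.dvd_or_dvd h with h | h
      · exact not_dvd_C hp hμ h
      · exact h2 p hp hpx h
    · refine ⟨i, lf a b y * v, by ring, ?_⟩
      intro p hp hpx h
      rcases hp.dvd_or_dvd h with h | h
      · exact hd (pen_det Q hp hpx h)
      · exact h2 p hp hpx h

lemma pen_val (Q : Pencil w D a b N) {x : k × k} (hx : x ≠ 0) {a1 b1 : (MvPolynomial (Fin 3) k)} {n : ℕ}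
    (ka1 : D a1 = 0) (kb1 : D b1 = 0) (ha1 : IsWeightedHomogeneous w a1 n)
    (hb1 : IsWeightedHomogeneous w b1 n) (ha0 : a1 ≠ 0) (hb0 : b1 ≠ 0) :
    ∃ (i : ℕ) (v v' : (MvPolynomial (Fin 3) k)), (∀ p, Prime p → p ∣ lf a b x → ¬ p ∣ v) ∧
      (∀ p, Prime p → p ∣ lf a b x → ¬ p ∣ v') ∧
      (a1 * lf a b x ^ i * v = b1 * v' ∨ a1 * v = b1 * lf a b x ^ i * v') := by
  obtain ⟨s, t, c, c', hs, ht, hc, hc', he⟩ := Q.rep a1 b1 n ka1 kb1 ha1 hb1 ha0 hb0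
  obtain ⟨i, v, h1, h2⟩ := multiset_split Q hx s hs
  obtain ⟨j, v', h1', h2'⟩ := multiset_split Q hx t ht
  have hx0 : lf a b x ≠ 0 := fun h => hx (Q.ind x h)
  rw [h1, h1'] at he
  have hv : ∀ p, Prime p → p ∣ lf a b x → ¬ p ∣ C c * v := fun p hp hpx h =>
    (hp.dvd_or_dvd h).elim (not_dvd_C hp hc) (h2 p hp hpx)
  have hv' : ∀ p, Prime p → p ∣ lf a b x → ¬ p ∣ C c' * v' := fun p hp hpx h =>
    (hp.dvd_or_dvd h).elim (not_dvd_C hp hc') (h2' p hp hpx)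
  rcases le_total i j with h | h
  · obtain ⟨l, rfl⟩ := Nat.exists_eq_add_of_le h
    refine ⟨l, _, _, hv, hv', Or.inr ?_⟩
    apply mul_left_cancel₀ (pow_ne_zero i hx0)
    rw [pow_add] at he
    linear_combination he
  · obtain ⟨l, rfl⟩ := Nat.exists_eq_add_of_le h
    refine ⟨l, _, _, hv, hv', Or.inl ?_⟩
    apply mul_left_cancel₀ (pow_ne_zero j hx0)
    rw [pow_add] at he
    linear_combination he

lemma pen_assoc (S : Setup w D) (Q : Pencil w D a b N) {x : k × k} (hx : x ≠ 0) {p q : (MvPolynomial (Fin 3) k)} {d e : ℕ}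
    (hp : HP w D p d) (hq : HP w D q e) (hpx : p ∣ lf a b x) (hqx : q ∣ lf a b x) : Associated p q := by
  by_contra hna
  have hpq : ¬ p ∣ q := fun h => hna (hp.pr.associated_of_dvd hq.pr h)
  have hqp : ¬ q ∣ p := fun h => hna (hq.pr.associated_of_dvd hp.pr h).symm
  have hd := hp.pos S
  have he := hq.pos S
  obtain ⟨i, v, v', hv, hv', h⟩ := pen_val Q hx (a1 := p^e) (b1 := q^d) (n := e * d)
    (by simp [hp.ker]) (by simp [hq.ker]) (homog_pow hp.hom e) (by rw [mul_comm]; exact homog_pow hq.hom d)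
    (pow_ne_zero _ hp.pr.ne_zero) (pow_ne_zero _ hq.pr.ne_zero)
  rcases h with h | h
  · have : p ∣ q^d * v' := by
      rw [← h, mul_assoc]; exact (dvd_pow_self p he.ne').mul_right _
    rcases hp.pr.dvd_or_dvd this with h | h
    · exact hpq (hp.pr.dvd_of_dvd_pow h)
    · exact hv' p hp.pr hpx h
  · have : q ∣ p^e * v := by
      rw [h, mul_assoc]; exact (dvd_pow_self q hd.ne').mul_right _
    rcases hq.pr.dvd_or_dvd this with h | h
    · exact hqp (hq.pr.dvd_of_dvd_pow h)
    · exact hv q hq.pr hqx h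

lemma pen_pow (S : Setup w D) (Q : Pencil w D a b N) {x : k × k} (hx : x ≠ 0) {p : (MvPolynomial (Fin 3) k)} {d : ℕ}
    (hp : HP w D p d) (hpx : p ∣ lf a b x) : d ∣ N ∧ ∃ u : k, u ≠ 0 ∧ lf a b x = C u * p ^ (N / d) := by
  have hx0 : lf a b x ≠ 0 := fun h => hx (Q.ind x h)
  have hd := hp.pos S
  have hfin : FiniteMultiplicity p (lf a b x) := FiniteMultiplicity.of_prime_left hp.pr hx0
  obtain ⟨v, hv, hpv⟩ := hfin.exists_eq_pow_mul_and_not_dvd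
  set m := multiplicity p (lf a b x) with hm
  have hhom := homog_lf Q.ha Q.hb x
  have hker := ker_lf Q.ka Q.kb x
  have hhv := hhom
  rw [hv] at hhv
  obtain ⟨i, n, hi, hn, hin⟩ := homog_of_mul hhv (by rw [← hv]; exact hx0)
  have hi' : i = m * d := homog_unique (pow_ne_zero _ hp.pr.ne_zero) hi (homog_pow hp.hom m)
  have hv0 : v ≠ 0 := by rintro rfl; simp at hpv
  have hkv : D v = 0 := ker_of_dvd S.lnd hx0 hker ⟨p^m, by rw [mul_comm]; exact hv⟩
  rcases Nat.eq_zero_or_pos n with rfl | hn0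
  · obtain ⟨c, rfl⟩ := homog_zero_const S.hw hn
    have hN : N = m * d := by omega
    refine ⟨⟨m, by rw [hN]; ring⟩, c, by rintro rfl; simp at hv0, ?_⟩
    rw [hv, hN, Nat.mul_div_cancel _ hd, mul_comm]
  · exfalso
    obtain ⟨q, e, c, hq, hqc, -⟩ := exists_HP S hv0 hkv hn hn0
    have hqv : q ∣ v := ⟨c, hqc⟩
    have : Associated p q := pen_assoc S Q hx hp hq hpx (by rw [hv]; exact hqv.mul_left _)
    exact hpv (this.dvd.trans hqv)

lemma pen_ex [IsAlgClosed k] (S : Setup w D) (Q : Pencil w D a b N) {p : (MvPolynomial (Fin 3) k)} {d : ℕ}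
    (hp : HP w D p d) : d ∣ N ∧ ∃ x : k × k, x ≠ 0 ∧ lf a b x = p ^ (N / d) := by
  obtain ⟨c, e, hce, hd⟩ := DEP S hp Q.pos Q.ha Q.hb Q.ka Q.kb
  have hx : ((c, e) : k × k) ≠ 0 := by
    intro h
    rw [Prod.mk_eq_zero] at h
    tauto
  obtain ⟨h1, u, hu, h2⟩ := pen_pow S Q hx hp hd
  refine ⟨h1, (u⁻¹ * c, u⁻¹ * e), ?_, ?_⟩
  · intro h
    rw [Prod.mk_eq_zero] at h
    simp [hu] at h
    tauto
  · rw [lf_smul u⁻¹ (c, e), h2, ← mul_assoc, ← C_mul, inv_mul_cancel₀ hu, C_1, one_mul]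

lemma clean [IsAlgClosed k] (S : Setup w D) : ∃ N : ℕ, 0 < N ∧ (∀ p d, HP w D p d → d ∣ N) ∧
    (∀ p d q e, HP w D p d → HP w D q e → ¬ Associated p q → Nat.Coprime (N / d) (N / e)) ∧
    (∀ p d q e r f, HP w D p d → HP w D q e → ¬ Associated p q → HP w D r f →
      ∃ x y : k, r ^ (N / f) = C x * p ^ (N / d) + C y * q ^ (N / e)) := by
  obtain ⟨a, b, N, Q⟩ := exists_pencil S
  have hmpos : ∀ p d, HP w D p d → N / d ≠ 0 := fun p d hp =>
    (Nat.div_pos (Nat.le_of_dvd Q.pos (pen_ex S Q hp).1) (hp.pos S)).ne'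
  refine ⟨N, Q.pos, fun p d hp => (pen_ex S Q hp).1, ?_, ?_⟩
  · intro p d q e hp hq hna
    obtain ⟨hdN, x, hx, hxp⟩ := pen_ex S Q hp
    obtain ⟨heN, y, hy, hyq⟩ := pen_ex S Q hq
    have hm := hmpos p d hp
    have hl := hmpos q e hq
    have hmd : N / d * d = N := Nat.div_mul_cancel hdN
    have hle : N / e * e = N := Nat.div_mul_cancel heN
    have hpq : ¬ p ∣ q := fun h => hna (hp.pr.associated_of_dvd hq.pr h)
    set m := N / d
    set l := N / e
    obtain ⟨g, hg⟩ : ∃ g, g = Nat.gcd m l := ⟨_, rfl⟩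
    have hg0 : 0 < g := by rw [hg]; exact Nat.gcd_pos_of_pos_left _ (Nat.pos_of_ne_zero hm)
    obtain ⟨m', hm'⟩ : g ∣ m := by rw [hg]; exact Nat.gcd_dvd_left _ _
    obtain ⟨l', hl'⟩ : g ∣ l := by rw [hg]; exact Nat.gcd_dvd_right _ _
    have hm0 : m' ≠ 0 := by rintro rfl; exact hm (by simpa using hm')
    have hdeg : l' * e = m' * d := by
      apply Nat.eq_of_mul_eq_mul_left hg0
      rw [← mul_assoc, ← mul_assoc, ← hl', ← hm', hmd, hle]
    have hpx : p ∣ lf a b x := by rw [hxp]; exact dvd_pow_self _ hm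
    obtain ⟨i, v, v', hv, hv', h⟩ := pen_val Q hx (a1 := p^m') (b1 := q^l') (n := m' * d)
      (by simp [hp.ker]) (by simp [hq.ker]) (homog_pow hp.hom m') (by rw [← hdeg]; exact homog_pow hq.hom l')
      (pow_ne_zero _ hp.pr.ne_zero) (pow_ne_zero _ hq.pr.ne_zero)
    have key : ∀ (z : (MvPolynomial (Fin 3) k)), p^m' * z ≠ q^l' * v' := by
      intro z h
      have : p ∣ q^l' * v' := by rw [← h]; exact (dvd_pow_self p hm0).mul_right _
      rcases hp.pr.dvd_or_dvd this with h | h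
      · exact hpq (hp.pr.dvd_of_dvd_pow h)
      · exact hv' p hp.pr hpx h
    rcases h with h | h
    · exact absurd (by rw [← h, mul_assoc]) (key (lf a b x ^ i * v))
    · have hi : i ≠ 0 := by
        rintro rfl
        exact key v (by rw [h]; ring)
      have h3 : p ^ m ∣ p^m' * v := by
        rw [h, hxp]
        exact ((dvd_pow_self (p^m) hi).mul_left _).mul_right _
      have h4 : p^m ∣ p^m' := hp.pr.pow_dvd_of_dvd_mul_right m (hv p hp.pr hpx) h3
      have h5 : m ≤ m' := (pow_dvd_pow_iff hp.pr.ne_zero hp.pr.not_unit).1 h4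
      rw [Nat.Coprime, ← hg]
      rw [hm'] at h5
      have : g ≤ 1 := by
        by_contra hg1
        have : 2 * m' ≤ g * m' := Nat.mul_le_mul_right _ (by omega)
        omega
      omega
  · intro p d q e r f hp hq hna hr
    obtain ⟨hdN, x, hx, hxp⟩ := pen_ex S Q hp
    obtain ⟨heN, y, hy, hyq⟩ := pen_ex S Q hq
    obtain ⟨hfN, z, hz, hzr⟩ := pen_ex S Q hr
    rw [← hxp, ← hyq, ← hzr]
    have hdet : x.1 * y.2 - x.2 * y.1 ≠ 0 := by
      intro h
      obtain ⟨μ, hμ, h1⟩ := pair_prop hx hy (sub_eq_zero.1 h)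
      apply hna
      apply pen_assoc S Q hy hp hq
      · rw [h1, lf_smul, hxp]
        exact (dvd_pow_self p (hmpos p d hp)).mul_left _
      · rw [hyq]; exact dvd_pow_self q (hmpos q e hq)
    refine ⟨(z.1 * y.2 - z.2 * y.1) / (x.1 * y.2 - x.2 * y.1),
      (x.1 * z.2 - x.2 * z.1) / (x.1 * y.2 - x.2 * y.1), ?_⟩
    have e1 : z.1 = (z.1 * y.2 - z.2 * y.1) / (x.1 * y.2 - x.2 * y.1) * x.1 +
      (x.1 * z.2 - x.2 * z.1) / (x.1 * y.2 - x.2 * y.1) * y.1 := by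
      rw [div_mul_eq_mul_div, div_mul_eq_mul_div, ← add_div, eq_div_iff hdet]; ring
    have e2 : z.2 = (z.1 * y.2 - z.2 * y.1) / (x.1 * y.2 - x.2 * y.1) * x.2 +
      (x.1 * z.2 - x.2 * z.1) / (x.1 * y.2 - x.2 * y.1) * y.2 := by
      rw [div_mul_eq_mul_div, div_mul_eq_mul_div, ← add_div, eq_div_iff hdet]; ring
    generalize (z.1 * y.2 - z.2 * y.1) / (x.1 * y.2 - x.2 * y.1) = α at *
    generalize (x.1 * z.2 - x.2 * z.1) / (x.1 * y.2 - x.2 * y.1) = β at *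
    simp only [lf, e1, e2, map_add, map_mul]
    ring

end Pen
end MZ

namespace MZ

section EEight
variable {k : Type} [Field k] [CharZero k] {w : Fin 3 → ℕ} {D : Derivation k (MvPolynomial (Fin 3) k) (MvPolynomial (Fin 3) k)}

lemma der_sum (δ : Derivation k (MvPolynomial (Fin 3) k) (MvPolynomial (Fin 3) k)) (f : (MvPolynomial (Fin 3) k)) : δ f = ∑ i, δ (X i) * pderiv i f := by
  have : δ = (δ (X 0)) • pderiv 0 + (δ (X 1)) • pderiv 1 + (δ (X 2)) • pderiv 2 := by
    apply MvPolynomial.derivation_ext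
    intro j
    fin_cases j <;> simp [pderiv_X, Pi.single_apply]
  conv_lhs => rw [this]
  rw [Fin.sum_univ_three]
  rfl

lemma eul_pderiv (i : Fin 3) (f : (MvPolynomial (Fin 3) k)) : eul w (pderiv i f) = pderiv i (eul w f) - C (w i : k) * pderiv i f := by
  have : ⁅(eul w : Derivation k (MvPolynomial (Fin 3) k) (MvPolynomial (Fin 3) k)), pderiv i⁆ = (-(w i : k)) • (pderiv i : Derivation k (MvPolynomial (Fin 3) k) (MvPolynomial (Fin 3) k)) := by
    apply MvPolynomial.derivation_ext
    intro j
    rw [Derivation.commutator_apply, eul, mkDerivation_X, Derivation.map_smul]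
    by_cases h : j = i
    · subst h; simp
    · simp [pderiv_X_of_ne h]
  have h := congrArg (fun d => d f) this
  simp only [Derivation.commutator_apply] at h
  have h2 : ((-(w i : k)) • (pderiv i : Derivation k (MvPolynomial (Fin 3) k) (MvPolynomial (Fin 3) k))) f = - (C (w i : k) * pderiv i f) := by
    rw [Derivation.smul_apply, smul_eq_C_mul, C_neg, neg_mul]
  rw [h2] at h
  linear_combination h

/-- Euler eigenvector -/
def Eg (w : Fin 3 → ℕ) (l : k) (f : (MvPolynomial (Fin 3) k)) : Prop := eul w f = C l * f

lemma Eg.mul {l m : k} {f g : (MvPolynomial (Fin 3) k)} (hf : Eg w l f) (hg : Eg w m g) : Eg w (l + m) (f * g) := by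
  unfold Eg at *
  rw [Derivation.leibniz, hf, hg, smul_eq_mul, smul_eq_mul, C_add]; ring

lemma Eg.add {l : k} {f g : (MvPolynomial (Fin 3) k)} (hf : Eg w l f) (hg : Eg w l g) : Eg w l (f + g) := by
  unfold Eg at *
  rw [map_add, hf, hg]; ring

lemma Eg.sub {l : k} {f g : (MvPolynomial (Fin 3) k)} (hf : Eg w l f) (hg : Eg w l g) : Eg w l (f - g) := by
  unfold Eg at *
  rw [map_sub, hf, hg]; ring

lemma Eg.C (c : k) : Eg w 0 (C c : (MvPolynomial (Fin 3) k)) := by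
  unfold Eg
  simp

lemma Eg.cancel {l m n : k} {f g : (MvPolynomial (Fin 3) k)} (hf : Eg w l f) (hfg : Eg w m (f * g)) (h0 : f ≠ 0) (hn : n = m - l) :
    Eg w n g := by
  unfold Eg at *
  rw [Derivation.leibniz, hf, smul_eq_mul, smul_eq_mul] at hfg
  apply mul_left_cancel₀ h0
  rw [hn, C_sub]
  linear_combination hfg

lemma Eg.pderiv {l : k} {f : (MvPolynomial (Fin 3) k)} (hf : Eg w l f) (i : Fin 3) : Eg w (l - w i) (pderiv i f) := by
  unfold Eg at *
  rw [eul_pderiv, hf, Derivation.leibniz, C_sub]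
  simp
  ring

lemma Eg.of {n : ℕ} {f : (MvPolynomial (Fin 3) k)} (hf : IsWeightedHomogeneous w f n) : Eg w (n : k) f := by
  unfold Eg
  rw [eul_homog hf, smul_eq_C_mul]

lemma Eg.cast {l m : k} {f : (MvPolynomial (Fin 3) k)} (hf : Eg w l f) (h : l = m) : Eg w m f := h ▸ hf

lemma Eg.nat {f : (MvPolynomial (Fin 3) k)} {n : ℤ} (h : Eg w (n : k) f) (h0 : f ≠ 0) : ∃ m : ℕ, (m : ℤ) = n ∧ IsWeightedHomogeneous w f m :=
  homog_of_eul h0 (by rw [smul_eq_C_mul]; exact h)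

/-- data for the E8 exclusion -/
structure E8 (w : Fin 3 → ℕ) (D : Derivation k (MvPolynomial (Fin 3) k) (MvPolynomial (Fin 3) k)) (f g h : (MvPolynomial (Fin 3) k)) (E : ℕ) : Prop where
  pos : 0 < E
  hf : HP w D f (15 * E)
  hg : HP w D g (10 * E)
  hh : HP w D h (6 * E)
  fg : ¬ f ∣ g
  hfn : ¬ h ∣ f
  hgn : ¬ h ∣ g
  eq : f ^ 2 + g ^ 3 + h ^ 5 = 0

variable {f g h : (MvPolynomial (Fin 3) k)} {E : ℕ}

lemma E8.exb (T : E8 w D f g h E) (i : Fin 3) : ∃ b : (MvPolynomial (Fin 3) k), f * b = 3 * h * pderiv i g - 5 * g * pderiv i h ∧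
    g ^ 2 * b = 5 * f * pderiv i h - 2 * h * pderiv i f ∧ Eg w ((E : k) - w i) b := by
  have hd : 2 * f * pderiv i f + 3 * g^2 * pderiv i g + 5 * h^4 * pderiv i h = 0 := by
    have := congrArg (pderiv i) T.eq
    simp only [map_add, Derivation.leibniz_pow, map_zero, nsmul_eq_mul, smul_eq_mul] at this
    norm_num at this
    linear_combination this
  have key : g ^ 2 * (3 * h * pderiv i g - 5 * g * pderiv i h) = f * (5 * f * pderiv i h - 2 * h * pderiv i f) := by
    linear_combination h * hd - 5 * pderiv i h * T.eq
  have h1 : f ∣ 3 * h * pderiv i g - 5 * g * pderiv i h := by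
    have h2 : f ∣ g ^ 2 * (3 * h * pderiv i g - 5 * g * pderiv i h) := ⟨_, key⟩
    exact (T.hf.pr.dvd_or_dvd h2).resolve_left (fun h => T.fg (T.hf.pr.dvd_of_dvd_pow h))
  obtain ⟨b, hb⟩ := h1
  have hf0 := T.hf.pr.ne_zero
  refine ⟨b, hb.symm, ?_, ?_⟩
  · apply mul_left_cancel₀ hf0
    rw [← key, hb]; ring
  · have e1 := (Eg.of T.hh.hom).mul ((Eg.of T.hg.hom).pderiv i)
    have e2 := (Eg.of T.hg.hom).mul ((Eg.of T.hh.hom).pderiv i)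
    have e3 : Eg w (16 * (E:k) - w i) (f * b) := by
      rw [← hb]
      have e1' := (Eg.C 3).mul e1
      have e2' := (Eg.C 5).mul e2
      have := (e1'.cast (m := 16 * (E:k) - w i) (by push_cast; ring)).sub (e2'.cast (by push_cast; ring))
      convert this using 1
      simp only [map_ofNat]; ring
    exact Eg.cancel (Eg.of T.hf.hom) e3 hf0 (by push_cast; ring)

/-- the graded module -/
structure Mod (w : Fin 3 → ℕ) (f g h : (MvPolynomial (Fin 3) k)) (E : ℕ) (n : ℤ) (U W : (MvPolynomial (Fin 3) k)) : Prop where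
  dvd : h ∣ f * U - g * W
  hU : Eg w (n : k) U
  hW : Eg w ((n + 5 * E : ℤ) : k) W

lemma Mod.step (T : E8 w D f g h E) {n : ℤ} {U W : (MvPolynomial (Fin 3) k)} (M : Mod w f g h E n U W) (i : Fin 3) {b : (MvPolynomial (Fin 3) k)}
    (hb1 : f * b = 3 * h * pderiv i g - 5 * g * pderiv i h)
    (hb2 : g ^ 2 * b = 5 * f * pderiv i h - 2 * h * pderiv i f) (hb3 : Eg w ((E : k) - w i) b) :
    ∃ R R' : (MvPolynomial (Fin 3) k), 5 * pderiv i h * U + b * W = h * R ∧ 5 * pderiv i h * W - g * b * U = h * R' ∧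
      Mod w f g h E (n - w i) (pderiv i U - C (1/60) * R) (pderiv i W - 11 * C (1/60) * R') := by
  have hpr := T.hh.pr
  have hh0 := hpr.ne_zero
  obtain ⟨P, hP⟩ := M.dvd
  have hQ : h ∣ g ^ 2 * U + f * W := by
    have : h ∣ g * (g ^ 2 * U + f * W) := ⟨- f * P - h^4 * U, by linear_combination (-f) * hP + U * T.eq⟩
    exact (hpr.dvd_or_dvd this).resolve_left T.hgn
  obtain ⟨Q, hQ⟩ := hQ
  have hR : h ∣ 5 * pderiv i h * U + b * W := by
    have : h ∣ f * (5 * pderiv i h * U + b * W) :=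
      ⟨5 * pderiv i h * P + 3 * pderiv i g * W, by linear_combination W * hb1 + 5 * pderiv i h * hP⟩
    exact (hpr.dvd_or_dvd this).resolve_left T.hfn
  have hR' : h ∣ 5 * pderiv i h * W - g * b * U := by
    have : h ∣ f * (5 * pderiv i h * W - g * b * U) :=
      ⟨5 * pderiv i h * Q - 3 * g * pderiv i g * U, by linear_combination (-g * U) * hb1 + 5 * pderiv i h * hQ⟩
    exact (hpr.dvd_or_dvd this).resolve_left T.hfn
  have hPQ : f * P + g * Q = - h^4 * U := by
    apply mul_left_cancel₀ hh0
    linear_combination (-f) * hP - g * hQ + U * T.eq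
  have hS : h ∣ 5 * pderiv i h * P - b * Q := by
    have : h ∣ f * (5 * pderiv i h * P - b * Q) :=
      ⟨- 5 * pderiv i h * h^3 * U - 3 * pderiv i g * Q, by linear_combination (-Q) * hb1 + 5 * pderiv i h * hPQ⟩
    exact (hpr.dvd_or_dvd this).resolve_left T.hfn
  obtain ⟨R, hR⟩ := hR
  obtain ⟨R', hR'⟩ := hR'
  obtain ⟨V, hV⟩ := hS
  have hc : (60 : (MvPolynomial (Fin 3) k)) * C (1/60 : k) = 1 := by
    have : (60 : (MvPolynomial (Fin 3) k)) = C (60 : k) := (map_ofNat C 60).symm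
    rw [this, ← C_mul]; norm_num
  have ed : pderiv i f * U + f * pderiv i U - pderiv i g * W - g * pderiv i W = pderiv i h * P + h * pderiv i P := by
    have := congrArg (pderiv i) hP
    simp only [map_sub, Derivation.leibniz, smul_eq_mul] at this
    linear_combination this
  have hEh := Eg.of (k := k) T.hh.hom
  have hEg := Eg.of (k := k) T.hg.hom
  have hER : Eg w (((n - w i : ℤ) : k)) R := by
    have h1 := (Eg.C 5).mul ((hEh.pderiv i).mul M.hU)
    have h2 := hb3.mul M.hW
    have h3 := (h1.cast (m := 6 * (E : k) - w i + n) (by push_cast; ring)).add (h2.cast (by push_cast; ring))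
    refine Eg.cancel hEh (m := 6 * (E : k) - w i + n) ?_ hh0 (by push_cast; ring)
    rw [← hR]
    convert h3 using 1
    simp only [map_ofNat]; ring
  have hER' : Eg w (((n - w i + 5 * E : ℤ) : k)) R' := by
    have h1 := (Eg.C 5).mul ((hEh.pderiv i).mul M.hW)
    have h2 := (hEg.mul hb3).mul M.hU
    have h3 := (h1.cast (m := 11 * (E : k) - w i + n) (by push_cast; ring)).sub (h2.cast (by push_cast; ring))
    refine Eg.cancel hEh (m := 11 * (E : k) - w i + n) ?_ hh0 (by push_cast; ring)
    rw [← hR']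
    convert h3 using 1
    simp only [map_ofNat]; ring
  refine ⟨R, R', hR, hR', ⟨pderiv i P - 19 * C (1/60) * V, ?_⟩, ?_, ?_⟩
  · generalize (C (1/60 : k) : (MvPolynomial (Fin 3) k)) = c at *
    apply mul_left_cancel₀ hh0
    linear_combination h * ed + c * f * hR - 11 * c * g * hR' - (pderiv i h + 95 * c * pderiv i h) * hP
      + 19 * c * b * hQ - 30 * c * U * hb2 - 20 * c * W * hb1 +
      (U * (h * pderiv i f - pderiv i h * f) + W * (pderiv i h * g - h * pderiv i g)) * hc - 19 * c * h * hV
  · exact ((M.hU.pderiv i).cast (by push_cast; ring)).sub (((Eg.C (1/60)).mul hER).cast (by push_cast; ring))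
  · have : (11 : (MvPolynomial (Fin 3) k)) * C (1/60 : k) = C (11 / 60) := by
      have : (11 : (MvPolynomial (Fin 3) k)) = C (11 : k) := (map_ofNat C 11).symm
      rw [this, ← C_mul]; norm_num
    rw [this]
    exact ((M.hW.pderiv i).cast (by push_cast; ring)).sub (((Eg.C (11/60)).mul hER').cast (by push_cast; ring))

lemma E8.false (S : Setup w D) (T : E8 w D f g h E)
    (hmin : ∀ a n, D a = 0 → a ≠ 0 → IsWeightedHomogeneous w a n → 0 < n → 6 * E ≤ n) : False := by
  have hh0 := T.hh.pr.ne_zero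
  have hf0 := T.hf.pr.ne_zero
  obtain ⟨n, ⟨U, W, M, hne⟩, hleast⟩ := Int.exists_least_of_bdd
    (P := fun n => ∃ U W, Mod w f g h E n U W ∧ (U ≠ 0 ∨ W ≠ 0))
    ⟨-(5 * E : ℤ), by
      rintro n ⟨U, W, M, h0 | h0⟩
      · obtain ⟨m, hm, -⟩ := M.hU.nat h0
        omega
      · obtain ⟨m, hm, -⟩ := M.hW.nat h0
        omega⟩
    ⟨10 * E, g, f, ⟨by rw [mul_comm g f, sub_self]; exact dvd_zero _, (Eg.of T.hg.hom).cast (by push_cast; ring),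
      (Eg.of T.hf.hom).cast (by push_cast; ring)⟩, Or.inl T.hg.pr.ne_zero⟩
  have hstep : ∀ i, ∃ b : (MvPolynomial (Fin 3) k), f * b = 3 * h * pderiv i g - 5 * g * pderiv i h ∧
      h * pderiv i U = C (1/60) * (5 * pderiv i h * U + b * W) ∧
      h * pderiv i W = 11 * C (1/60) * (5 * pderiv i h * W - g * b * U) := by
    intro i
    obtain ⟨b, hb1, hb2, hb3⟩ := T.exb i
    obtain ⟨R, R', h1, h2, h3⟩ := M.step T i hb1 hb2 hb3
    have h4 : pderiv i U - C (1/60) * R = 0 ∧ pderiv i W - 11 * C (1/60) * R' = 0 := by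
      by_contra hcon
      have := hleast _ ⟨_, _, h3, by tauto⟩
      have := S.hw i
      omega
    refine ⟨b, hb1, ?_, ?_⟩
    · rw [h1]; linear_combination h * h4.1
    · rw [h2]; linear_combination h * h4.2
  choose b hb1 hU hW using hstep
  have key : ∀ δ : Derivation k (MvPolynomial (Fin 3) k) (MvPolynomial (Fin 3) k), 3 * h * δ g = 5 * g * δ h →
      h * δ U = C (1/60) * (5 * δ h * U) ∧ h * δ W = 11 * C (1/60) * (5 * δ h * W) := by
    intro δ hδ
    have hb0 : ∑ i, δ (X i) * b i = 0 := by
      apply mul_left_cancel₀ hf0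
      rw [der_sum δ g, der_sum δ h] at hδ
      simp only [Fin.sum_univ_three] at hδ ⊢
      linear_combination δ (X 0) * hb1 0 + δ (X 1) * hb1 1 + δ (X 2) * hb1 2 + hδ
    rw [der_sum δ U, der_sum δ W, der_sum δ h]
    simp only [Fin.sum_univ_three] at hb0 ⊢
    constructor
    · linear_combination δ (X 0) * hU 0 + δ (X 1) * hU 1 + δ (X 2) * hU 2 + C (1/60) * W * hb0
    · linear_combination δ (X 0) * hW 0 + δ (X 1) * hW 1 + δ (X 2) * hW 2 - 11 * C (1/60) * g * U * hb0
  have hc : (60 : (MvPolynomial (Fin 3) k)) * C (1/60 : k) = 1 := by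
    have : (60 : (MvPolynomial (Fin 3) k)) = C (60 : k) := (map_ofNat C 60).symm
    rw [this, ← C_mul]; norm_num
  obtain ⟨hDU, hDW⟩ := key D (by rw [T.hg.ker, T.hh.ker]; ring)
  rw [T.hh.ker] at hDU hDW
  have kU : D U = 0 := mul_left_cancel₀ hh0 (by rw [hDU]; ring)
  have kW : D W = 0 := mul_left_cancel₀ hh0 (by rw [hDW]; ring)
  have hEh := Eg.of (k := k) T.hh.hom
  have hEg := Eg.of (k := k) T.hg.hom
  have eU := M.hU
  have eW := M.hW
  unfold Eg at hEh hEg eU eW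
  obtain ⟨hEU, hEW⟩ := key (eul w) (by
    rw [hEh, hEg]
    simp only [Nat.cast_mul, map_mul, Nat.cast_ofNat, map_ofNat]
    ring)
  rw [hEh, eU] at hEU
  rw [hEh, eW] at hEW
  have hE := T.pos
  rcases hne with h0 | h0
  · have h2 : C (2 * (n : k)) = (C (E : k) : (MvPolynomial (Fin 3) k)) := by
      apply mul_left_cancel₀ (mul_ne_zero hh0 h0)
      simp only [Nat.cast_mul, map_mul, Nat.cast_ofNat, map_ofNat] at hEU ⊢
      linear_combination 2 * hEU + h * U * C (E:k) * hc
    have h3 := C_injective _ _ h2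
    have h4 : 2 * n = E := by exact_mod_cast h3
    obtain ⟨m, hm, hm2⟩ := M.hU.nat h0
    have := hmin U m kU h0 hm2 (by omega)
    omega
  · have h2 : C (2 * ((n + 5 * E : ℤ) : k)) = (C (11 * E : k) : (MvPolynomial (Fin 3) k)) := by
      apply mul_left_cancel₀ (mul_ne_zero hh0 h0)
      simp only [Nat.cast_mul, map_mul, Nat.cast_ofNat, map_ofNat] at hEW ⊢
      linear_combination 2 * hEW + 11 * h * W * C (E:k) * hc
    have h3 := C_injective _ _ h2
    have h4 : 2 * (n + 5 * E) = 11 * E := by exact_mod_cast h3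
    obtain ⟨m, hm, hm2⟩ := M.hW.nat h0
    have := hmin W m kW h0 hm2 (by omega)
    omega

end EEight
end MZ

namespace MZ

section MainAC
variable {k : Type} [Field k] [CharZero k] {w : Fin 3 → ℕ} {D : Derivation k (MvPolynomial (Fin 3) k) (MvPolynomial (Fin 3) k)}

lemma homog_X_pderiv {f : (MvPolynomial (Fin 3) k)} {n : ℕ} (hf : IsWeightedHomogeneous w f n) (i : Fin 3) :
    IsWeightedHomogeneous w (X i * pderiv i f) n := by
  by_cases h0 : pderiv i f = 0
  · rw [h0, mul_zero]; exact isWeightedHomogeneous_zero k w n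
  have h1 := (Eg.of (k := k) hf).pderiv i
  obtain ⟨m, hm, hm2⟩ := Eg.nat (n := (n : ℤ) - w i) (h1.cast (by push_cast; ring)) h0
  have := (isWeightedHomogeneous_X k w i).mul hm2
  have hn : w i + m = n := by omega
  rwa [hn] at this

lemma pow_pred_dvd_pderiv (p : (MvPolynomial (Fin 3) k)) (m : ℕ) (i : Fin 3) (c : k) : p ^ (m - 1) ∣ pderiv i (C c * p ^ m) := by
  rw [pderiv_C_mul, Derivation.leibniz_pow, nsmul_eq_mul, smul_eq_mul]
  exact Dvd.intro_left (C c * ((m : (MvPolynomial (Fin 3) k)) * pderiv i p)) (by ring)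

lemma relprime_of {p q : (MvPolynomial (Fin 3) k)} (hp : Prime p) (hq : Prime q) (h : ¬ Associated p q) (m n : ℕ) :
    IsRelPrime (p ^ m) (q ^ n) :=
  IsRelPrime.pow ((hp.irreducible.isRelPrime_iff_not_dvd).2 (fun hd => h (hp.associated_of_dvd hq hd)))

lemma FC (S : Setup w D) {p q r : (MvPolynomial (Fin 3) k)} {d e f m l n N : ℕ} (hp : HP w D p d) (hq : HP w D q e) (hr : HP w D r f)
    (hpq : ¬ Associated p q) (hpr : ¬ Associated p r) (hqr : ¬ Associated q r)
    (hm : m * d = N) (hl : l * e = N) (hn : n * f = N) (hN : 0 < N) {x y z : k} (hx : x ≠ 0) (hy : y ≠ 0)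
    (heq : C x * p ^ m + C y * q ^ l + C z * r ^ n = 0) : N < d + e + f := by
  set u := C x * p ^ m with hu
  set v := C y * q ^ l with hv
  set t := C z * r ^ n with ht
  have hm0 : m ≠ 0 := by rintro rfl; omega
  have hl0 : l ≠ 0 := by rintro rfl; omega
  have hn0 : n ≠ 0 := by rintro rfl; omega
  have hCx : (C x : (MvPolynomial (Fin 3) k)) ≠ 0 := by simpa using hx
  have hCy : (C y : (MvPolynomial (Fin 3) k)) ≠ 0 := by simpa using hy
  have hu0 : u ≠ 0 := mul_ne_zero hCx (pow_ne_zero _ hp.pr.ne_zero)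
  have hv0 : v ≠ 0 := mul_ne_zero hCy (pow_ne_zero _ hq.pr.ne_zero)
  have hhu : IsWeightedHomogeneous w u N := by rw [← hm]; exact homog_C_mul x (homog_pow hp.hom m)
  have hhv : IsWeightedHomogeneous w v N := by rw [← hl]; exact homog_C_mul y (homog_pow hq.hom l)
  obtain ⟨i, hi⟩ : ∃ i, pderiv i u * v ≠ u * pderiv i v := by
    by_contra hcon
    push Not at hcon
    obtain ⟨c, hc, h⟩ := WR hu0 hv0 hcon
    have h1 : p ∣ C c * v := by
      rw [← h]; exact (dvd_pow_self p hm0).mul_left _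
    rcases hp.pr.dvd_or_dvd h1 with h1 | h1
    · exact not_dvd_C hp.pr hc h1
    · rcases hp.pr.dvd_or_dvd h1 with h1 | h1
      · exact not_dvd_C hp.pr hy h1
      · exact hpq (hp.pr.associated_of_dvd hq.pr (hp.pr.dvd_of_dvd_pow h1))
  have hW0 : pderiv i u * v - u * pderiv i v ≠ 0 := sub_ne_zero.2 hi
  have hpu : p ^ (m-1) ∣ u := (pow_dvd_pow p (Nat.sub_le m 1)).mul_left _
  have hqv : q ^ (l-1) ∣ v := (pow_dvd_pow q (Nat.sub_le l 1)).mul_left _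
  have hrt : r ^ (n-1) ∣ t := (pow_dvd_pow r (Nat.sub_le n 1)).mul_left _
  have hpu' : p ^ (m-1) ∣ pderiv i u := pow_pred_dvd_pderiv p m i x
  have hqv' : q ^ (l-1) ∣ pderiv i v := pow_pred_dvd_pderiv q l i y
  have hrt' : r ^ (n-1) ∣ pderiv i t := pow_pred_dvd_pderiv r n i z
  have d1 : p ^ (m-1) ∣ pderiv i u * v - u * pderiv i v := dvd_sub (hpu'.mul_right _) (hpu.mul_right _)
  have d2 : q ^ (l-1) ∣ pderiv i u * v - u * pderiv i v := dvd_sub (hqv.mul_left _) (hqv'.mul_left _)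
  have d3 : r ^ (n-1) ∣ pderiv i u * v - u * pderiv i v := by
    have hd := congrArg (pderiv i) heq
    simp only [map_add, map_zero] at hd
    have : pderiv i u * v - u * pderiv i v = u * pderiv i t - t * pderiv i u := by
      linear_combination pderiv i u * heq - u * hd
    rw [this]
    exact dvd_sub (hrt'.mul_left _) (hrt.mul_right _)
  have r12 := relprime_of hp.pr hq.pr hpq (m-1) (l-1)
  have r13 := relprime_of hp.pr hr.pr hpr (m-1) (n-1)
  have r23 := relprime_of hq.pr hr.pr hqr (l-1) (n-1)
  have d12 := r12.mul_dvd d1 d2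
  have d123 := (IsRelPrime.mul_left r13 r23).mul_dvd d12 d3
  have hhW : IsWeightedHomogeneous w (X i * (pderiv i u * v - u * pderiv i v)) (N + N) := by
    have h1 := (homog_X_pderiv hhu i).mul hhv
    have h2 := hhu.mul (homog_X_pderiv hhv i)
    have h3 := (weightedHomogeneousSubmodule k w (N + N)).sub_mem h1 h2
    have h4 : X i * (pderiv i u * v - u * pderiv i v) = X i * pderiv i u * v - u * (X i * pderiv i v) := by ring
    rw [h4]; exact h3
  have hXW0 : X i * (pderiv i u * v - u * pderiv i v) ≠ 0 := mul_ne_zero (X_ne_zero i) hW0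
  obtain ⟨j, hj, hj2⟩ := homog_of_dvd hhW hXW0 (mul_dvd_mul_left (X i) d123)
  have hprod := (isWeightedHomogeneous_X k w i).mul
    (((homog_pow hp.hom (m-1)).mul (homog_pow hq.hom (l-1))).mul (homog_pow hr.hom (n-1)))
  have hjj := homog_unique (mul_ne_zero (X_ne_zero i) (mul_ne_zero (mul_ne_zero (pow_ne_zero _ hp.pr.ne_zero)
    (pow_ne_zero _ hq.pr.ne_zero)) (pow_ne_zero _ hr.pr.ne_zero))) hj2 hprod
  have hwi := S.hw i
  have a1 : (m-1) * d + d = N := by rw [← hm]; cases m <;> simp_all [Nat.succ_mul]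
  have a2 : (l-1) * e + e = N := by rw [← hl]; cases l <;> simp_all [Nat.succ_mul]
  have a3 : (n-1) * f + f = N := by rw [← hn]; cases n <;> simp_all [Nat.succ_mul]
  omega

lemma arith {m l n d e f N : ℕ} (hN : 0 < N) (hm : m * d = N) (hl : l * e = N) (hn : n * f = N) (h : N < d + e + f)
    (hm2 : 2 ≤ m) (h1 : m < l) (h2 : l < n) (c1 : Nat.Coprime m l) (c2 : Nat.Coprime m n) (c3 : Nat.Coprime l n) :
    m = 2 ∧ l = 3 ∧ n = 5 := by
  have h3 : m * l * n < l * n + m * n + m * l := by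
    have hd : d * (m * l * n) = N * (l * n) := by rw [← hm]; ring
    have he : e * (m * l * n) = N * (m * n) := by rw [← hl]; ring
    have hf : f * (m * l * n) = N * (m * l) := by rw [← hn]; ring
    have : 0 < m * l * n := Nat.mul_pos (Nat.mul_pos (by omega) (by omega)) (by omega)
    have h4 : N * (m * l * n) < (d + e + f) * (m * l * n) := Nat.mul_lt_mul_of_pos_right h this
    rw [add_mul, add_mul, hd, he, hf, ← mul_add, ← mul_add] at h4
    exact Nat.lt_of_mul_lt_mul_left h4
  have hm3 : m = 2 := by
    by_contra hne
    have : 3 ≤ m := by omega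
    nlinarith [Nat.mul_le_mul_right (l * n) this, Nat.mul_lt_mul_of_pos_right h1 (show 0 < n by omega),
      Nat.mul_lt_mul_of_pos_right h2 (show 0 < l by omega), Nat.mul_lt_mul_of_pos_right (h1.trans h2) (show 0 < l by omega)]
  subst hm3
  have hl3 : l = 3 := by
    by_contra hne
    have hl4 : l ≠ 4 := by rintro rfl; revert c1; decide
    have h5 : 5 ≤ l := by omega
    nlinarith
  subst hl3
  refine ⟨rfl, rfl, ?_⟩
  have : n < 6 := by omega
  interval_cases n
  · revert c2; decide
  · rfl

lemma arith' {N d : ℕ} (h : d ∣ N) (hN : 0 < N) : N / d * d = N := Nat.div_mul_cancel h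

lemma HP.scale {p : (MvPolynomial (Fin 3) k)} {d : ℕ} (hp : HP w D p d) {c : k} (hc : c ≠ 0) : HP w D (C c * p) d where
  pr := by
    have hu : IsUnit (C c : (MvPolynomial (Fin 3) k)) := (isUnit_iff_ne_zero.2 hc).map C
    exact (associated_unit_mul_left p _ hu).symm.prime hp.pr
  ker := by rw [← smul_eq_C_mul, Derivation.map_smul, hp.ker, smul_zero]
  hom := homog_C_mul c hp.hom

lemma exists_root [IsAlgClosed k] (x : k) (n : ℕ) (hn : 0 < n) : ∃ c : k, c ^ n = x :=
  IsAlgClosed.exists_pow_nat_eq x hn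

lemma no_three [IsAlgClosed k] (S : Setup w D) {N : ℕ} (hN : 0 < N) (H1 : ∀ p d, HP w D p d → d ∣ N)
    (H2 : ∀ p d q e, HP w D p d → HP w D q e → ¬ Associated p q → Nat.Coprime (N / d) (N / e))
    (H3 : ∀ p d q e r f, HP w D p d → HP w D q e → ¬ Associated p q → HP w D r f →
      ∃ x y : k, r ^ (N / f) = C x * p ^ (N / d) + C y * q ^ (N / e))
    {p q r : (MvPolynomial (Fin 3) k)} {d e f : ℕ} (hp : HP w D p d) (hq : HP w D q e) (hr : HP w D r f)
    (hpq : ¬ Associated p q) (hpr : ¬ Associated p r) (hqr : ¬ Associated q r)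
    (h2p : 2 ≤ N / d) (h2q : 2 ≤ N / e) (h2r : 2 ≤ N / f) : False := by
  -- nonvanishing of the coefficients
  have nv : ∀ p d q e r f, HP w D p d → HP w D q e → ¬ Associated p q → HP w D r f → ¬ Associated p r →
      ¬ Associated q r → ∃ x y : k, x ≠ 0 ∧ y ≠ 0 ∧ C x * p ^ (N / d) + C y * q ^ (N / e) + C (-1) * r ^ (N / f) = 0 := by
    intro p d q e r f hp hq hpq hr hpr hqr
    obtain ⟨x, y, h⟩ := H3 p d q e r f hp hq hpq hr
    have hf0 : N / f ≠ 0 := by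
      have := arith' (H1 _ _ hr) hN
      rintro h; rw [h] at this; omega
    refine ⟨x, y, ?_, ?_, by rw [h, C_neg, C_1]; ring⟩
    · rintro rfl
      have h1 : r ∣ C y * q ^ (N / e) := by
        have : C y * q ^ (N / e) = r ^ (N / f) := by rw [h, C_0]; ring
        rw [this]; exact dvd_pow_self r hf0
      by_cases hy : y = 0
      · subst hy
        rw [C_0, zero_mul, zero_mul, add_zero] at h
        exact pow_ne_zero _ hr.pr.ne_zero h
      · rcases hr.pr.dvd_or_dvd h1 with h1 | h1
        · exact not_dvd_C hr.pr hy h1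
        · exact hqr (hr.pr.associated_of_dvd hq.pr (hr.pr.dvd_of_dvd_pow h1)).symm
    · rintro rfl
      have h1 : r ∣ C x * p ^ (N / d) := by
        have : C x * p ^ (N / d) = r ^ (N / f) := by rw [h, C_0]; ring
        rw [this]; exact dvd_pow_self r hf0
      by_cases hx : x = 0
      · subst hx
        rw [C_0, zero_mul, zero_mul, add_zero] at h
        exact pow_ne_zero _ hr.pr.ne_zero h
      · rcases hr.pr.dvd_or_dvd h1 with h1 | h1
        · exact not_dvd_C hr.pr hx h1
        · exact hpr (hr.pr.associated_of_dvd hp.pr (hr.pr.dvd_of_dvd_pow h1)).symm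
  have sorted : ∀ p d q e r f, HP w D p d → HP w D q e → ¬ Associated p q → HP w D r f → ¬ Associated p r →
      ¬ Associated q r → 2 ≤ N / d → N / d < N / e → N / e < N / f → N / d = 2 ∧ N / e = 3 ∧ N / f = 5 := by
    intro p d q e r f hp hq hpq hr hpr hqr h2 h3 h4
    obtain ⟨x, y, hx, hy, h⟩ := nv p d q e r f hp hq hpq hr hpr hqr
    have hd := arith' (H1 _ _ hp) hN
    have he := arith' (H1 _ _ hq) hN
    have hf := arith' (H1 _ _ hr) hN
    exact arith hN hd he hf (FC S hp hq hr hpq hpr hqr hd he hf hN hx hy h) h2 h3 h4 (H2 _ _ _ _ hp hq hpq)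
      (H2 _ _ _ _ hp hr hpr) (H2 _ _ _ _ hq hr hqr)
  have fin : ∀ p d q e r f, HP w D p d → HP w D q e → ¬ Associated p q → HP w D r f → ¬ Associated p r →
      ¬ Associated q r → 2 ≤ N / d → N / d < N / e → N / e < N / f → False := by
    intro p d q e r f hp hq hpq hr hpr hqr h2 h3 h4
    obtain ⟨e1, e2, e3⟩ := sorted p d q e r f hp hq hpq hr hpr hqr h2 h3 h4
    have hd := arith' (H1 _ _ hp) hN
    have he := arith' (H1 _ _ hq) hN
    have hf := arith' (H1 _ _ hr) hN
    obtain ⟨x, y, hx, hy, h⟩ := nv q e r f p d hq hr hqr hp (fun h => hpq h.symm) (fun h => hpr h.symm)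
    rw [e1, e2, e3] at h
    rw [e1] at hd
    rw [e2] at he
    rw [e3] at hf
    obtain ⟨E, hE⟩ : ∃ E, N = 30 * E := ⟨N / 30, by omega⟩
    have hdE : d = 15 * E := by omega
    have heE : e = 10 * E := by omega
    have hfE : f = 6 * E := by omega
    obtain ⟨c, hc⟩ := exists_root (-x) 3 (by norm_num)
    obtain ⟨c', hc'⟩ := exists_root (-y) 5 (by norm_num)
    have hc0 : c ≠ 0 := by rintro rfl; apply hx; simpa using hc.symm
    have hc0' : c' ≠ 0 := by rintro rfl; apply hy; simpa using hc'.symm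
    rw [hdE] at hp
    rw [heE] at hq
    rw [hfE] at hr
    have hnd : ∀ {a b : (MvPolynomial (Fin 3) k)} {c : k}, Prime a → Prime b → c ≠ 0 → ¬ Associated a b → ¬ a ∣ C c * b := by
      intro a b c ha hb hc hab hdv
      rcases ha.dvd_or_dvd hdv with h | h
      · exact not_dvd_C ha hc h
      · exact hab (ha.associated_of_dvd hb h)
    have hr2 := hr.scale hc0'
    refine E8.false S (f := p) (g := C c * q) (h := C c' * r) (E := E) ⟨by omega, hp, hq.scale hc0, hr2,
      hnd hp.pr hq.pr hc0 hpq, ?_, ?_, ?_⟩ ?_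
    · intro hd
      exact hpr (hr.pr.associated_of_dvd hp.pr (dvd_of_mul_left_dvd hd)).symm
    · intro hd
      exact hnd hr.pr hq.pr hc0 (fun h => hqr h.symm) (dvd_of_mul_left_dvd hd)
    · rw [mul_pow, mul_pow, ← C_pow, ← C_pow, hc, hc', C_neg, C_neg]
      rw [C_neg, C_1] at h
      linear_combination -h
    · intro a n ka ha0 hha hn
      obtain ⟨s, g, c2, hs, -, -, -, hgn, -⟩ := exists_HP S ha0 ka hha hn
      refine le_trans ?_ hgn
      by_contra hlt
      push Not at hlt
      have hs0 := hs.pos S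
      have hsN := arith' (H1 _ _ hs) hN
      have h6 : 6 ≤ N / g := by
        by_contra h5
        have : N / g * g ≤ 5 * g := Nat.mul_le_mul_right _ (by omega)
        omega
      have hq1 := arith' (H1 _ _ hq) hN
      have hr1 := arith' (H1 _ _ hr) hN
      have hq3 : N / (10 * E) = 3 := by rw [hE]; exact Nat.div_eq_of_eq_mul_left (by omega) (by ring)
      have hr5 : N / (6 * E) = 5 := by rw [hE]; exact Nat.div_eq_of_eq_mul_left (by omega) (by ring)
      have na : ∀ t dt, HP w D t dt → 6 * E ≤ dt → ¬ Associated t s := by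
        intro t dt ht hdt has
        obtain ⟨c3, hc3, h3⟩ := assoc_const S.hw has
        have := homog_unique hs.pr.ne_zero hs.hom (by rw [h3]; exact homog_C_mul c3 ht.hom)
        omega
      obtain ⟨h7, -, -⟩ := sorted q (10 * E) r (6 * E) s g hq hr hqr hs (na q _ hq (by omega)) (na r _ hr (by omega))
        (by omega) (by omega) (by omega)
      omega
  have ne : ∀ {a b : ℕ}, 2 ≤ a → Nat.Coprime a b → a ≠ b := by
    rintro a b h1 h2 rfl
    rw [Nat.coprime_self] at h2; omega
  have n1 := ne h2p (H2 _ _ _ _ hp hq hpq)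
  have n2 := ne h2p (H2 _ _ _ _ hp hr hpr)
  have n3 := ne h2q (H2 _ _ _ _ hq hr hqr)
  have hqp : ¬ Associated q p := fun h => hpq h.symm
  have hrp : ¬ Associated r p := fun h => hpr h.symm
  have hrq : ¬ Associated r q := fun h => hqr h.symm
  rcases lt_or_gt_of_ne n1 with a | a <;> rcases lt_or_gt_of_ne n2 with b | b <;> rcases lt_or_gt_of_ne n3 with c | c
  · exact fin p d q e r f hp hq hpq hr hpr hqr h2p a c
  · exact fin p d r f q e hp hr hpr hq hpq hrq h2p b c
  · omega
  · exact fin r f p d q e hr hp hrp hq hrq hpq h2r b a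
  · exact fin q e p d r f hq hp hqp hr hqr hpr h2q a b
  · omega
  · exact fin q e r f p d hq hr hqr hp hqp hrp h2q c b
  · exact fin r f q e p d hr hq hrq hp hrp hqp h2r c a

theorem main_ac [IsAlgClosed k] (S : Setup w D) : ∃ F G d e, HP w D F d ∧ HP w D G e ∧ ¬ Associated F G ∧
    ∀ r, D r = 0 → r ∈ Algebra.adjoin k ({F, G} : Set (MvPolynomial (Fin 3) k)) := by
  obtain ⟨N, hN, H1, H2, H3⟩ := clean S
  have hex : ∃ F G d e, HP w D F d ∧ HP w D G e ∧ ¬ Associated F G ∧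
      ∀ r f, HP w D r f → 2 ≤ N / f → Associated F r ∨ Associated G r := by
    by_cases hs : ∃ F G d e, HP w D F d ∧ HP w D G e ∧ ¬ Associated F G ∧ 2 ≤ N / d ∧ 2 ≤ N / e
    · obtain ⟨F, G, d, e, hF, hG, hna, hd, he⟩ := hs
      refine ⟨F, G, d, e, hF, hG, hna, ?_⟩
      intro r f hr hf
      by_contra hcon
      push Not at hcon
      exact no_three S hN H1 H2 H3 hF hG hr hna hcon.1 hcon.2 hd he hf
    · push Not at hs
      obtain ⟨F, G, d, e, hF, hG, hna⟩ := exists_two_HP S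
      by_cases hsp : ∃ P f, HP w D P f ∧ 2 ≤ N / f
      · obtain ⟨P, f, hP, hf⟩ := hsp
        have : ∃ G e, HP w D G e ∧ ¬ Associated P G := by
          by_cases h : Associated P F
          · exact ⟨G, e, hG, fun h2 => hna (h.symm.trans h2)⟩
          · exact ⟨F, d, hF, h⟩
        obtain ⟨G', e', hG', hna'⟩ := this
        refine ⟨P, G', f, e', hP, hG', hna', ?_⟩
        intro r f' hr hf'
        left
        by_contra hcon
        have := hs P r f f' hP hr hcon hf
        omega
      · push Not at hsp
        refine ⟨F, G, d, e, hF, hG, hna, ?_⟩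
        intro r f hr hf
        have := hsp r f hr
        omega
  obtain ⟨F, G, d, e, hF, hG, hna, hcov⟩ := hex
  refine ⟨F, G, d, e, hF, hG, hna, ?_⟩
  apply ker_le_of_HP S
  intro p f hp
  have hFm : F ∈ Algebra.adjoin k ({F, G} : Set (MvPolynomial (Fin 3) k)) := Algebra.subset_adjoin (by simp)
  have hGm : G ∈ Algebra.adjoin k ({F, G} : Set (MvPolynomial (Fin 3) k)) := Algebra.subset_adjoin (by simp)
  have hCm : ∀ c : k, C c ∈ Algebra.adjoin k ({F, G} : Set (MvPolynomial (Fin 3) k)) := fun c => Subalgebra.algebraMap_mem _ c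
  by_cases h2 : 2 ≤ N / f
  · rcases hcov p f hp h2 with h | h
    · obtain ⟨c, -, rfl⟩ := assoc_const S.hw h
      exact mul_mem (hCm c) hFm
    · obtain ⟨c, -, rfl⟩ := assoc_const S.hw h
      exact mul_mem (hCm c) hGm
  · obtain ⟨x, y, h⟩ := H3 F d G e p f hF hG hna hp
    have h1 : N / f = 1 := by
      have := arith' (H1 _ _ hp) hN
      have h0 : N / f ≠ 0 := by intro h; rw [h] at this; omega
      generalize N / f = t at *
      omega
    rw [h1, pow_one] at h
    rw [h]
    exact add_mem (mul_mem (hCm x) (pow_mem hFm _)) (mul_mem (hCm y) (pow_mem hGm _))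

end MainAC
end MZ

namespace MZ

section Desc
variable {k : Type} [Field k] [CharZero k] {w : Fin 3 → ℕ} {D : Derivation k (MvPolynomial (Fin 3) k) (MvPolynomial (Fin 3) k)}
variable {K : Type} [Field K] [CharZero K] [Algebra k K]

lemma decomp {σ I : Type} (β : Module.Basis I k K) (r : MvPolynomial σ K) :
    ∃ c : I →₀ MvPolynomial σ k, r = c.sum (fun j f => C (β j) * map (algebraMap k K) f) := by
  induction r using MvPolynomial.induction_on' with
  | monomial d a =>
    refine ⟨(β.repr a).mapRange (fun x => monomial d x) (by simp), ?_⟩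
    rw [Finsupp.sum_mapRange_index (by simp)]
    conv_lhs => rw [← β.linearCombination_repr a, Finsupp.linearCombination_apply]
    rw [Finsupp.sum, Finsupp.sum, map_sum]
    apply Finset.sum_congr rfl
    intro j _
    rw [map_monomial, C_mul_monomial, Algebra.smul_def, mul_comm]
  | add p q hp hq =>
    obtain ⟨c, hc⟩ := hp
    obtain ⟨c', hc'⟩ := hq
    refine ⟨c + c', ?_⟩
    rw [Finsupp.sum_add_index' (by simp) (by intro j a b; rw [map_add, mul_add]), ← hc, ← hc']

lemma decomp_zero {σ I : Type} (β : Module.Basis I k K) (c : I →₀ MvPolynomial σ k)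
    (h : c.sum (fun j f => C (β j) * map (algebraMap k K) f) = 0) : c = 0 := by
  ext j d
  have h1 := congrArg (coeff d) h
  rw [Finsupp.sum, coeff_sum, coeff_zero] at h1
  have hli := linearIndependent_iff'.1 β.linearIndependent c.support (fun j => coeff d (c j)) (by
    rw [← h1]
    apply Finset.sum_congr rfl
    intro j _
    rw [coeff_C_mul, coeff_map, Algebra.smul_def, mul_comm])
  by_cases hj : j ∈ c.support
  · simpa using hli j hj
  · rw [Finsupp.notMem_support_iff] at hj
    simp [hj]

/-- extended derivation -/
def Dbar (K : Type) [Field K] [Algebra k K] (D : Derivation k (MvPolynomial (Fin 3) k) (MvPolynomial (Fin 3) k)) :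
    Derivation K (MvPolynomial (Fin 3) K) (MvPolynomial (Fin 3) K) :=
  mkDerivation K (fun i => map (algebraMap k K) (D (X i)))

lemma Dbar_map (f : (MvPolynomial (Fin 3) k)) : Dbar K D (map (algebraMap k K) f) = map (algebraMap k K) (D f) := by
  rw [der_sum (Dbar K D), der_sum D, map_sum]
  apply Finset.sum_congr rfl
  intro i _
  rw [Dbar, mkDerivation_X, map_mul, pderiv_map]

lemma Dbar_decomp {I : Type} (β : Module.Basis I k K) (r : MvPolynomial (Fin 3) K) (h : Dbar K D r = 0) :
    ∃ c : I →₀ (MvPolynomial (Fin 3) k), (∀ j, D (c j) = 0) ∧ r = c.sum (fun j f => C (β j) * map (algebraMap k K) f) := by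
  obtain ⟨c, hc⟩ := decomp β r
  refine ⟨c, ?_, hc⟩
  have h1 : (c.mapRange D (map_zero D)).sum (fun j f => C (β j) * map (algebraMap k K) f) = 0 := by
    rw [Finsupp.sum_mapRange_index (by simp), ← h, hc, Finsupp.sum, Finsupp.sum, map_sum]
    apply Finset.sum_congr rfl
    intro j _
    rw [← smul_eq_C_mul, ← smul_eq_C_mul, Derivation.map_smul, Dbar_map]
  have h2 := decomp_zero β _ h1
  intro j
  have := congrArg (fun c => c j) h2
  simpa using this

lemma comp_map (f : (MvPolynomial (Fin 3) k)) (n : ℕ) : weightedHomogeneousComponent w n (map (algebraMap k K) f) =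
    map (algebraMap k K) (weightedHomogeneousComponent w n f) := by
  ext d
  rw [coeff_weightedHomogeneousComponent, coeff_map, coeff_map, coeff_weightedHomogeneousComponent]
  split_ifs <;> simp

lemma homog_map {f : (MvPolynomial (Fin 3) k)} {n : ℕ} (h : IsWeightedHomogeneous w f n) :
    IsWeightedHomogeneous w (map (algebraMap k K) f) n := by
  intro d hd
  apply h
  rw [coeff_map] at hd
  intro h0; rw [h0, map_zero] at hd; exact hd rfl

lemma setup_bar (S : Setup w D) : Setup w (Dbar K D) where
  lnd := by
    apply lnd_of_X
    intro i
    obtain ⟨n, hn⟩ := S.lnd (X i)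
    refine ⟨n, ?_⟩
    have : ∀ (n : ℕ) (f : (MvPolynomial (Fin 3) k)), (Dbar K D)^[n] (map (algebraMap k K) f) = map (algebraMap k K) (D^[n] f) := by
      intro n
      induction n with
      | zero => intro f; rfl
      | succ n ih => intro f; rw [Function.iterate_succ_apply, Function.iterate_succ_apply, Dbar_map, ih]
    have h2 := this n (X i)
    rw [hn, map_X, map_zero] at h2
    exact h2
  hw := S.hw
  ne := by
    intro h
    apply S.ne
    apply Derivation.ext
    intro f
    have h1 := Dbar_map (K := K) (D := D) f
    rw [h] at h1
    have h2 : map (algebraMap k K) (D f) = map (algebraMap k K) 0 := by rw [← h1]; simp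
    exact map_injective _ (algebraMap k K).injective h2
  gr := by
    intro f n hf
    obtain ⟨c, hc, hs⟩ := Dbar_decomp (Module.Basis.ofVectorSpace k K) f hf
    rw [hs, Finsupp.sum, map_sum, map_sum]
    apply Finset.sum_eq_zero
    intro j _
    rw [← smul_eq_C_mul, LinearMap.map_smul, Derivation.map_smul, comp_map, Dbar_map, S.gr _ _ (hc j)]
    simp

end Desc
end MZ

namespace MZ

section Desc2
variable {k : Type} [Field k] [CharZero k] {w : Fin 3 → ℕ} {D : Derivation k (MvPolynomial (Fin 3) k) (MvPolynomial (Fin 3) k)}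
variable {K : Type} [Field K] [CharZero K] [Algebra k K]

lemma range_pair (F G : (MvPolynomial (Fin 3) k)) : ({F, G} : Set (MvPolynomial (Fin 3) k)) = Set.range ![F, G] := by
  rw [Matrix.range_cons, Matrix.range_cons, Matrix.range_empty, Set.union_empty]
  rfl

lemma mem_pair {F G x : (MvPolynomial (Fin 3) k)} (hx : x ∈ Algebra.adjoin k ({F, G} : Set (MvPolynomial (Fin 3) k))) :
    ∃ P : MvPolynomial (Fin 2) k, aeval ![F, G] P = x := by
  rw [range_pair, Algebra.adjoin_range_eq_range_aeval] at hx
  exact hx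

lemma C_mem_sub (s : Subalgebra k (MvPolynomial (Fin 3) k)) (c : k) : C c ∈ s := s.algebraMap_mem c

lemma comp_mono {F G : (MvPolynomial (Fin 3) k)} {d e : ℕ} (hF : IsWeightedHomogeneous w F d) (hG : IsWeightedHomogeneous w G e)
    (hd : 0 < d) (he : 0 < e) (a : k) (i j : ℕ) :
    ∃ (κ : k) (z : (MvPolynomial (Fin 3) k)), z ∈ Algebra.adjoin k ({F} : Set (MvPolynomial (Fin 3) k)) ∧
      weightedHomogeneousComponent w e (C a * (F ^ i * G ^ j)) = C κ * G + z := by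
  have hm2 : IsWeightedHomogeneous w (C a * (F ^ i * G ^ j)) (i * d + j * e) :=
    homog_C_mul a ((homog_pow hF _).mul (homog_pow hG _))
  by_cases hdeg : i * d + j * e = e
  · rw [hdeg] at hm2
    rw [hm2.weightedHomogeneousComponent_same]
    rcases Nat.lt_or_ge j 1 with h1 | h1
    · refine ⟨0, C a * (F ^ i * G ^ j), ?_, by rw [C_0, zero_mul, zero_add]⟩
      have : j = 0 := by omega
      rw [this, pow_zero, mul_one]
      exact mul_mem (C_mem_sub _ a) (pow_mem (Algebra.self_mem_adjoin_singleton k F) _)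
    · have h2 : j * e ≥ 1 * e := Nat.mul_le_mul_right _ h1
      have h3 : i * d = 0 := by omega
      have h4 : i = 0 := by
        rcases Nat.mul_eq_zero.1 h3 with h | h
        · exact h
        · omega
      have h5 : j * e = 1 * e := by omega
      have h6 : j = 1 := Nat.eq_of_mul_eq_mul_right he h5
      exact ⟨a, 0, zero_mem _, by rw [h4, h6, pow_zero, one_mul, pow_one, add_zero]⟩
  · rw [hm2.weightedHomogeneousComponent_ne e (Ne.symm hdeg)]
    exact ⟨0, 0, zero_mem _, by rw [C_0, zero_mul, zero_add]⟩

lemma comp_mem_T {F G : (MvPolynomial (Fin 3) k)} {d e : ℕ} (hF : IsWeightedHomogeneous w F d) (hG : IsWeightedHomogeneous w G e)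
    (hd : 0 < d) (he : 0 < e) {x : (MvPolynomial (Fin 3) k)} (hx : x ∈ Algebra.adjoin k ({F, G} : Set (MvPolynomial (Fin 3) k))) :
    ∃ (κ : k) (z : (MvPolynomial (Fin 3) k)), z ∈ Algebra.adjoin k ({F} : Set (MvPolynomial (Fin 3) k)) ∧ weightedHomogeneousComponent w e x = C κ * G + z := by
  obtain ⟨P, hP⟩ := mem_pair hx
  clear hx
  induction P using MvPolynomial.induction_on' generalizing x with
  | monomial s a =>
    have hm : (aeval ![F, G] : MvPolynomial (Fin 2) k →ₐ[k] (MvPolynomial (Fin 3) k)) (monomial s a) = C a * (F ^ (s 0) * G ^ (s 1)) := by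
      rw [aeval_monomial, Finsupp.prod_fintype _ _ (by intro i; exact pow_zero _), Fin.prod_univ_two]
      rfl
    rw [← hP, hm]
    exact comp_mono hF hG hd he a _ _
  | add p q hp hq =>
    obtain ⟨κ, z, hz, h1⟩ := hp rfl
    obtain ⟨κ', z', hz', h1'⟩ := hq rfl
    refine ⟨κ + κ', z + z', add_mem hz hz', ?_⟩
    rw [← hP, map_add, map_add, h1, h1', C_add]
    ring

lemma RP {F G : MvPolynomial (Fin 3) K} {d e : ℕ} (S : Setup w D)
    (hF : IsWeightedHomogeneous w F d) (hG : IsWeightedHomogeneous w G e)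
    (hd : 0 < d) (he : 0 < e)
    (h : ∀ r, Dbar K D r = 0 ↔ r ∈ Algebra.adjoin K ({F, G} : Set (MvPolynomial (Fin 3) K))) :
    ∃ b : (MvPolynomial (Fin 3) k), IsWeightedHomogeneous w b e ∧ D b = 0 ∧
      ∀ r, Dbar K D r = 0 ↔ r ∈ Algebra.adjoin K ({F, map (algebraMap k K) b} : Set (MvPolynomial (Fin 3) K)) := by
  have Sb : Setup w (Dbar K D) := setup_bar S
  have hDF : Dbar K D F = 0 := (h F).2 (Algebra.subset_adjoin (Or.inl rfl))
  have hDG : Dbar K D G = 0 := (h G).2 (Algebra.subset_adjoin (Or.inr rfl))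
  set β := Module.Basis.ofVectorSpace k K
  obtain ⟨c, hc, hs⟩ := Dbar_decomp β G hDG
  have hbc : ∀ j, ∃ (κ : K) (z : MvPolynomial (Fin 3) K), z ∈ Algebra.adjoin K ({F} : Set (MvPolynomial (Fin 3) K)) ∧
      map (algebraMap k K) (weightedHomogeneousComponent w e (c j)) = C κ * G + z := by
    intro j
    rw [← comp_map]
    apply comp_mem_T hF hG hd he
    rw [← h, Dbar_map, hc j, map_zero]
  choose κ z hz hκ using hbc
  have hFs : F ∈ Algebra.adjoin K ({F} : Set (MvPolynomial (Fin 3) K)) := Algebra.subset_adjoin rfl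
  by_cases hall : ∀ j, κ j = 0
  · exfalso
    have hGm : G ∈ Algebra.adjoin K ({F} : Set (MvPolynomial (Fin 3) K)) := by
      rw [← hG.weightedHomogeneousComponent_same, hs, Finsupp.sum, map_sum]
      apply sum_mem
      intro j _
      rw [← smul_eq_C_mul, LinearMap.map_smul, comp_map, hκ, hall j, C_0, zero_mul, zero_add]
      exact Subalgebra.smul_mem _ (hz j) _
    obtain ⟨r, hr, hr'⟩ := ker_not_single Sb.lnd Sb.ne F
    apply hr'
    have := (h r).1 hr
    refine Algebra.adjoin_le ?_ this
    rintro x (rfl | rfl)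
    · exact hFs
    · exact hGm
  · push Not at hall
    obtain ⟨j, hj⟩ := hall
    have hDb : D (weightedHomogeneousComponent w e (c j)) = 0 := S.gr _ _ (hc j)
    refine ⟨weightedHomogeneousComponent w e (c j), weightedHomogeneousComponent_isWeightedHomogeneous _ _, hDb, ?_⟩
    intro r
    rw [h]
    have hle1 : Algebra.adjoin K ({F, G} : Set (MvPolynomial (Fin 3) K)) ≤
      Algebra.adjoin K ({F, map (algebraMap k K) (weightedHomogeneousComponent w e (c j))} : Set (MvPolynomial (Fin 3) K)) := by
      apply Algebra.adjoin_le
      rintro x (rfl | rfl)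
      · exact Algebra.subset_adjoin (Or.inl rfl)
      · have e1 : x = C (κ j)⁻¹ * (map (algebraMap k K) (weightedHomogeneousComponent w e (c j)) - z j) := by
          rw [hκ, add_sub_cancel_right, ← mul_assoc, ← C_mul, inv_mul_cancel₀ hj, C_1, one_mul]
        have hsub : Algebra.adjoin K ({F} : Set (MvPolynomial (Fin 3) K)) ≤ Algebra.adjoin K ({F, map (algebraMap k K) (weightedHomogeneousComponent w e (c j))} : Set (MvPolynomial (Fin 3) K)) :=
          Algebra.adjoin_mono (Set.singleton_subset_iff.2 (Or.inl rfl))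
        have hb : map (algebraMap k K) (weightedHomogeneousComponent w e (c j)) ∈ Algebra.adjoin K ({F, map (algebraMap k K) (weightedHomogeneousComponent w e (c j))} : Set (MvPolynomial (Fin 3) K)) :=
          Algebra.subset_adjoin (Or.inr rfl)
        have hm1 := mul_mem (C_mem_sub (Algebra.adjoin K ({F, map (algebraMap k K) (weightedHomogeneousComponent w e (c j))} : Set (MvPolynomial (Fin 3) K))) (κ j)⁻¹) (sub_mem hb (hsub (hz j)))
        rw [← e1] at hm1
        exact hm1
    have hle2 : Algebra.adjoin K ({F, map (algebraMap k K) (weightedHomogeneousComponent w e (c j))} : Set (MvPolynomial (Fin 3) K)) ≤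
       Algebra.adjoin K ({F, G} : Set (MvPolynomial (Fin 3) K)) := by
      apply Algebra.adjoin_le
      rintro x (rfl | rfl)
      · exact Algebra.subset_adjoin (Or.inl rfl)
      · exact (h _).1 (by rw [Dbar_map, hDb, map_zero])
    exact ⟨fun hr => hle1 hr, fun hr => hle2 hr⟩

lemma descend {F G : (MvPolynomial (Fin 3) k)} {r : (MvPolynomial (Fin 3) k)}
    (h : map (algebraMap k K) r ∈ Algebra.adjoin K ({map (algebraMap k K) F, map (algebraMap k K) G} : Set (MvPolynomial (Fin 3) K))) :
    r ∈ Algebra.adjoin k ({F, G} : Set (MvPolynomial (Fin 3) k)) := by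
  obtain ⟨P, hP⟩ := mem_pair h
  set β := Module.Basis.ofVectorSpace k K
  obtain ⟨c, hc⟩ := decomp β P
  have hev : ∀ Q : MvPolynomial (Fin 2) k, aeval ![map (algebraMap k K) F, map (algebraMap k K) G] (map (algebraMap k K) Q)
      = map (algebraMap k K) (aeval ![F, G] Q) := by
    intro Q
    induction Q using MvPolynomial.induction_on with
    | C a => rw [map_C, algHom_C, algHom_C, algebraMap_eq, algebraMap_eq, map_C]
    | add p q hp hq => rw [map_add, map_add, hp, hq, map_add, map_add]
    | mul_X p i hp =>
      rw [map_mul, map_mul, hp, map_mul, map_mul, map_X, aeval_X, aeval_X]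
      congr 1
      fin_cases i <;> rfl
  have h1 : (c.mapRange (fun Q => aeval ![F, G] Q) (map_zero _)).sum (fun j f => C (β j) * map (algebraMap k K) f) =
      map (algebraMap k K) r := by
    rw [← hP, hc, Finsupp.sum_mapRange_index (by intro j; rw [map_zero, mul_zero]), Finsupp.sum, Finsupp.sum, map_sum]
    apply Finset.sum_congr rfl
    intro j _
    rw [map_mul, hev, algHom_C, algebraMap_eq]
  have h2 : ((β.repr 1).mapRange (fun x : k => C x * r) (by rw [C_0, zero_mul])).sum (fun j f => C (β j) * map (algebraMap k K) f) =
      map (algebraMap k K) r := by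
    rw [Finsupp.sum_mapRange_index (by intro j; rw [map_zero, mul_zero])]
    have h3 := β.linearCombination_repr 1
    rw [Finsupp.linearCombination_apply, Finsupp.sum] at h3
    have h4 := congrArg (fun t => C t * map (algebraMap k K) r) h3
    simp only [C_1, one_mul] at h4
    rw [← h4, Finsupp.sum, map_sum, Finset.sum_mul]
    apply Finset.sum_congr rfl
    intro j _
    rw [map_mul, map_C, Algebra.smul_def, C_mul]
    ring
  have h5 : ((c.mapRange (fun Q => aeval ![F, G] Q) (map_zero _)) - ((β.repr 1).mapRange (fun x : k => C x * r) (by rw [C_0, zero_mul]))).sum (fun j f => C (β j) * map (algebraMap k K) f) = 0 := by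
    rw [Finsupp.sum_sub_index (by intro j a b; rw [map_sub, mul_sub]), h1, h2, sub_self]
  have h6 := sub_eq_zero.1 (decomp_zero β _ h5)
  have hne : β.repr 1 ≠ 0 := by
    intro h0
    have := β.repr.map_eq_zero_iff.1 h0
    exact one_ne_zero this
  obtain ⟨j, hj⟩ := Finsupp.ne_iff.1 hne
  have h7 := congrArg (fun c => c j) h6
  simp only [Finsupp.mapRange_apply] at h7
  rw [Finsupp.zero_apply] at hj
  have e1 : r = C (β.repr 1 j)⁻¹ * aeval ![F, G] (c j) := by
    rw [h7, ← mul_assoc, ← C_mul, inv_mul_cancel₀ hj, C_1, one_mul]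
  have hm : aeval ![F, G] (c j) ∈ Algebra.adjoin k ({F, G} : Set (MvPolynomial (Fin 3) k)) := by
    rw [range_pair, Algebra.adjoin_range_eq_range_aeval]
    exact ⟨_, rfl⟩
  rw [e1]
  exact mul_mem (C_mem_sub _ _) hm

lemma dvd_sub_const {p F G : (MvPolynomial (Fin 3) k)} (hF : p ∣ F) (hG : p ∣ G) {x : (MvPolynomial (Fin 3) k)} (hx : x ∈ Algebra.adjoin k ({F, G} : Set (MvPolynomial (Fin 3) k))) :
    ∃ c : k, p ∣ x - C c := by
  induction hx using Algebra.adjoin_induction with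
  | mem x hx =>
    refine ⟨0, ?_⟩
    rw [C_0, sub_zero]
    rcases hx with rfl | rfl
    · exact hF
    · exact hG
  | algebraMap r => exact ⟨r, by rw [algebraMap_eq, sub_self]; exact dvd_zero _⟩
  | add x y hx hy h1 h2 =>
    obtain ⟨c, u, hu⟩ := h1
    obtain ⟨c', v, hv⟩ := h2
    exact ⟨c + c', u + v, by rw [C_add]; linear_combination hu + hv⟩
  | mul x y hx hy h1 h2 =>
    obtain ⟨c, u, hu⟩ := h1
    obtain ⟨c', v, hv⟩ := h2
    exact ⟨c * c', u * y + C c * v, by rw [C_mul]; linear_combination hu * y + hv * C c⟩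

lemma main_k (S : Setup w D) : ∃ (F G : (MvPolynomial (Fin 3) k)) (d e : ℕ), IsWeightedHomogeneous w F d ∧ IsWeightedHomogeneous w G e ∧
    0 < d ∧ 0 < e ∧ D F = 0 ∧ D G = 0 ∧ (∀ p, Prime p → p ∣ F → p ∣ G → False) ∧ F ≠ 0 ∧ G ≠ 0 ∧
    ∀ r, D r = 0 ↔ r ∈ Algebra.adjoin k ({F, G} : Set (MvPolynomial (Fin 3) k)) := by
  have Sb : Setup w (Dbar (AlgebraicClosure k) D) := setup_bar S
  obtain ⟨F, G, d, e, hF, hG, -, hker⟩ := main_ac Sb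
  have hd : 0 < d := HP.pos Sb hF
  have he : 0 < e := HP.pos Sb hG
  have hk : ∀ r, Dbar (AlgebraicClosure k) D r = 0 ↔ r ∈ Algebra.adjoin (AlgebraicClosure k) ({F, G} : Set _) := by
    intro r
    refine ⟨hker r, fun hr => ?_⟩
    have : Algebra.adjoin (AlgebraicClosure k) ({F, G} : Set _) ≤ kerA (Dbar (AlgebraicClosure k) D) := by
      apply Algebra.adjoin_le
      rintro x (rfl | rfl)
      · exact hF.ker
      · exact hG.ker
    exact this hr
  obtain ⟨G', hG', hDG', hk2⟩ := RP S hF.hom hG.hom hd he hk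
  simp only [Set.pair_comm F] at hk2
  obtain ⟨F', hF', hDF', hk3⟩ := RP S (homog_map hG') hF.hom he hd hk2
  simp only [Set.pair_comm (map _ G')] at hk3
  have hk4 : ∀ r, D r = 0 ↔ r ∈ Algebra.adjoin k ({F', G'} : Set (MvPolynomial (Fin 3) k)) := by
    intro r
    constructor
    · intro hr
      apply descend (K := AlgebraicClosure k)
      rw [← hk3, Dbar_map, hr, map_zero]
    · intro hr
      have : Algebra.adjoin k ({F', G'} : Set (MvPolynomial (Fin 3) k)) ≤ kerA D := by
        apply Algebra.adjoin_le
        rintro x (rfl | rfl)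
        · exact hDF'
        · exact hDG'
      exact this hr
  have hF0 : F' ≠ 0 := by
    rintro rfl
    obtain ⟨r, hr, hr'⟩ := ker_not_single S.lnd S.ne G'
    apply hr'
    have := (hk4 r).1 hr
    refine Algebra.adjoin_le ?_ this
    rintro x (rfl | rfl)
    · exact zero_mem _
    · exact Algebra.subset_adjoin rfl
  have hG0 : G' ≠ 0 := by
    rintro rfl
    obtain ⟨r, hr, hr'⟩ := ker_not_single S.lnd S.ne F'
    apply hr'
    have := (hk4 r).1 hr
    refine Algebra.adjoin_le ?_ this
    rintro x (rfl | rfl)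
    · exact Algebra.subset_adjoin rfl
    · exact zero_mem _
  refine ⟨F', G', d, e, hF', hG', hd, he, hDF', hDG', ?_, hF0, hG0, hk4⟩
  intro p hp hpF hpG
  obtain ⟨n, -, hn⟩ := homog_of_dvd hF' hF0 hpF
  have hDp : D p = 0 := ker_of_dvd S.lnd hF0 hDF' hpF
  have hP : HP w D p n := ⟨hp, hDp, hn⟩
  obtain ⟨r, hr, hr'⟩ := ker_not_single S.lnd S.ne p
  apply hr'
  refine ker_le_of_HP S _ ?_ r hr
  intro q m hq
  obtain ⟨c, hc⟩ := dvd_sub_const hpF hpG ((hk4 q).1 hq.ker)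
  have hpq : p ∣ q := by
    have h1 := dvd_comp hn hc m
    have hC : IsWeightedHomogeneous w (C c : (MvPolynomial (Fin 3) k)) 0 := isWeightedHomogeneous_C w c
    have hm : m ≠ 0 := (HP.pos S hq).ne.symm
    rw [map_sub, hq.hom.weightedHomogeneousComponent_same, hC.weightedHomogeneousComponent_ne m hm, sub_zero] at h1
    exact h1
  obtain ⟨c, hc, rfl⟩ := assoc_const S.hw (hp.associated_of_dvd hq.pr hpq)
  exact mul_mem (C_mem_sub _ _) (Algebra.self_mem_adjoin_singleton k p)

end Desc2
end MZ

namespace MZ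

section Deg
variable {k : Type} [Field k] [CharZero k] {w : Fin 3 → ℕ} {D : Derivation k (MvPolynomial (Fin 3) k) (MvPolynomial (Fin 3) k)}

/-- components of the cross product of gradients -/
def cr (F G : (MvPolynomial (Fin 3) k)) (i : Fin 3) : (MvPolynomial (Fin 3) k) :=
  pderiv (i + 1) F * pderiv (i + 2) G - pderiv (i + 2) F * pderiv (i + 1) G

lemma cr0 (F G : (MvPolynomial (Fin 3) k)) : cr F G 0 = pderiv 1 F * pderiv 2 G - pderiv 2 F * pderiv 1 G := rfl
lemma cr1 (F G : (MvPolynomial (Fin 3) k)) : cr F G 1 = pderiv 2 F * pderiv 0 G - pderiv 0 F * pderiv 2 G := rfl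
lemma cr2 (F G : (MvPolynomial (Fin 3) k)) : cr F G 2 = pderiv 0 F * pderiv 1 G - pderiv 1 F * pderiv 0 G := rfl

lemma all3 {P : Fin 3 → Prop} (h0 : P 0) (h1 : P 1) (h2 : P 2) : ∀ i, P i := by
  intro i
  fin_cases i
  · exact h0
  · exact h1
  · exact h2

lemma pd_comm (i j : Fin 3) (f : (MvPolynomial (Fin 3) k)) : pderiv i (pderiv j f) = pderiv j (pderiv i f) := by
  have : ⁅(pderiv i : Derivation k (MvPolynomial (Fin 3) k) (MvPolynomial (Fin 3) k)), (pderiv j : Derivation k (MvPolynomial (Fin 3) k) (MvPolynomial (Fin 3) k))⁆ = 0 := by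
    apply MvPolynomial.derivation_ext
    intro l
    rw [Derivation.commutator_apply]
    simp only [pderiv_X, Pi.single_apply]
    split_ifs <;> simp
  have h2 := congrArg (fun δ : Derivation k (MvPolynomial (Fin 3) k) (MvPolynomial (Fin 3) k) => δ f) this
  simp only [Derivation.commutator_apply, Derivation.zero_apply] at h2
  exact sub_eq_zero.1 h2

lemma der3 (δ : Derivation k (MvPolynomial (Fin 3) k) (MvPolynomial (Fin 3) k)) (f : (MvPolynomial (Fin 3) k)) :
    δ f = δ (X 0) * pderiv 0 f + δ (X 1) * pderiv 1 f + δ (X 2) * pderiv 2 f := by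
  rw [der_sum δ f, Fin.sum_univ_three]

lemma eul3 {f : (MvPolynomial (Fin 3) k)} {n : ℕ} (h : IsWeightedHomogeneous w f n) :
    C (w 0 : k) * X 0 * pderiv 0 f + C (w 1 : k) * X 1 * pderiv 1 f + C (w 2 : k) * X 2 * pderiv 2 f = C (n : k) * f := by
  have h1 := eul_homog h
  rw [smul_eq_C_mul, der3] at h1
  simp only [eul, mkDerivation_X, smul_eq_C_mul] at h1
  exact h1

lemma cr_par {F G : (MvPolynomial (Fin 3) k)} (hF : D F = 0) (hG : D G = 0) (i j : Fin 3) :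
    cr F G i * D (X j) = cr F G j * D (X i) := by
  rw [der3] at hF hG
  revert i j
  apply all3 <;> apply all3 <;> simp only [cr0, cr1, cr2]
  · linear_combination (pderiv 2 G) * hF - (pderiv 2 F) * hG
  · linear_combination -(pderiv 1 G) * hF + (pderiv 1 F) * hG
  · linear_combination -(pderiv 2 G) * hF + (pderiv 2 F) * hG
  · linear_combination (pderiv 0 G) * hF - (pderiv 0 F) * hG
  · linear_combination (pderiv 1 G) * hF - (pderiv 1 F) * hG
  · linear_combination -(pderiv 0 G) * hF + (pderiv 0 F) * hG

lemma ex_ne (hD : D ≠ 0) : ∃ i, D (X i) ≠ 0 := by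
  by_contra hc
  push Not at hc
  apply hD
  apply MvPolynomial.derivation_ext
  intro i
  rw [hc i]; rfl

lemma cr_factor {F G : (MvPolynomial (Fin 3) k)} (hF : D F = 0) (hG : D G = 0) (hD : D ≠ 0) (hirr : IsIrreducibleDeriv D) :
    ∃ q, ∀ i, cr F G i = q * D (X i) := by
  obtain ⟨i, hi⟩ := ex_ne hD
  obtain ⟨v', c', g, hrel, h1, h2⟩ := UniqueFactorizationMonoid.exists_reduced_factors (D (X i)) hi (cr F G i)
  have hg : g ≠ 0 := by rintro rfl; rw [zero_mul] at h1; exact hi h1.symm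
  have h3 : ∀ j, c' * D (X j) = cr F G j * v' := by
    intro j
    apply mul_left_cancel₀ hg
    have := cr_par hF hG i j
    rw [← h1, ← h2] at this
    linear_combination this
  have hu : IsUnit v' := by
    apply hirr
    intro r
    rw [Ideal.mem_span_singleton, der_sum]
    apply Finset.dvd_sum
    intro j _
    apply Dvd.dvd.mul_right
    exact hrel.dvd_of_dvd_mul_left (Dvd.intro_left _ (h3 j).symm)
  obtain ⟨u, rfl⟩ := hu
  refine ⟨c' * ↑u⁻¹, fun j => ?_⟩
  have h4 : (u : (MvPolynomial (Fin 3) k)) * ↑u⁻¹ = 1 := Units.mul_inv u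
  linear_combination -(↑u⁻¹ : (MvPolynomial (Fin 3) k)) * h3 j - cr F G j * h4

lemma cr_antisymm {F G : (MvPolynomial (Fin 3) k)} {p : (MvPolynomial (Fin 3) k)} (h : ∀ i, p ∣ cr F G i) (i j : Fin 3) :
    p ∣ pderiv i F * pderiv j G - pderiv j F * pderiv i G := by
  have h0 := h 0
  have h1 := h 1
  have h2 := h 2
  rw [cr0] at h0
  rw [cr1] at h1
  rw [cr2] at h2
  have key : ∀ a b : (MvPolynomial (Fin 3) k), a = -b → p ∣ b → p ∣ a := fun a b e hb => by rw [e]; exact (dvd_neg).2 hb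
  revert i j
  apply all3 <;> apply all3
  · rw [sub_self]; exact dvd_zero _
  · exact h2
  · exact key _ _ (by ring) h1
  · exact key _ _ (by ring) h2
  · rw [sub_self]; exact dvd_zero _
  · exact h0
  · exact h1
  · exact key _ _ (by ring) h0
  · rw [sub_self]; exact dvd_zero _

lemma exists_prime_dvd_homog (hw : ∀ i, 0 < w i) {F : (MvPolynomial (Fin 3) k)} {d : ℕ} (hF : IsWeightedHomogeneous w F d) (hd : 0 < d) (h0 : F ≠ 0) :
    ∃ p, Prime p ∧ p ∣ F := by
  have hu : ¬ IsUnit F := by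
    intro hu
    have := homog_unique h0 hF (unit_homog hu)
    omega
  obtain ⟨p, hp, hpd⟩ := WfDvdMonoid.exists_irreducible_factor hu h0
  exact ⟨p, hp.prime, hpd⟩

/-- contracting with the Euler field -/
lemma contract {p F G : (MvPolynomial (Fin 3) k)} {d e : ℕ} (hF : IsWeightedHomogeneous w F d) (hG : IsWeightedHomogeneous w G e)
    (h : ∀ i j, p ∣ pderiv i F * pderiv j G - pderiv j F * pderiv i G) (i : Fin 3) :
    p ∣ C (e : k) * (pderiv i F * G) - C (d : k) * (F * pderiv i G) := by
  have e1 := eul3 (k := k) hF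
  have e2 := eul3 (k := k) hG
  obtain ⟨a, ha⟩ := h i 0
  obtain ⟨b, hb⟩ := h i 1
  obtain ⟨c, hc⟩ := h i 2
  refine ⟨C (w 0 : k) * X 0 * a + C (w 1 : k) * X 1 * b + C (w 2 : k) * X 2 * c, ?_⟩
  linear_combination C (w 0 : k) * X 0 * ha + C (w 1 : k) * X 1 * hb + C (w 2 : k) * X 2 * hc
    - pderiv i F * e2 + pderiv i G * e1

lemma cr_ne (hw : ∀ i, 0 < w i) {F G : (MvPolynomial (Fin 3) k)} {d e : ℕ} (hF : IsWeightedHomogeneous w F d) (hG : IsWeightedHomogeneous w G e)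
    (hd : 0 < d) (he : 0 < e) (hF0 : F ≠ 0) (hG0 : G ≠ 0)
    (hrel : ∀ p, Prime p → p ∣ F → p ∣ G → False) (h : ∀ i, cr F G i = 0) : False := by
  have h1 := contract (p := 0) hF hG (cr_antisymm (fun i => by rw [h i]))
  obtain ⟨c, hc, hcc⟩ := WR (u := F ^ e) (v := G ^ d) (pow_ne_zero _ hF0) (pow_ne_zero _ hG0) (by
    intro i
    have h2 := zero_dvd_iff.1 (h1 i)
    obtain ⟨d, rfl⟩ := Nat.exists_eq_succ_of_ne_zero hd.ne'
    obtain ⟨e, rfl⟩ := Nat.exists_eq_succ_of_ne_zero he.ne'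
    rw [Derivation.leibniz_pow, Derivation.leibniz_pow]
    simp only [nsmul_eq_mul, smul_eq_mul, Nat.succ_eq_add_one, Nat.add_sub_cancel] at h2 ⊢
    rw [C_eq_coe_nat, C_eq_coe_nat] at h2
    linear_combination F ^ e * G ^ d * h2)
  obtain ⟨p, hp, hpF⟩ := exists_prime_dvd_homog hw hF hd hF0
  have h3 : p ∣ C c * G ^ d := by rw [← hcc]; exact dvd_pow hpF he.ne'
  rcases hp.dvd_or_dvd h3 with h4 | h4
  · exact not_dvd_C hp hc h4
  · exact hrel p hp hpF (hp.dvd_of_dvd_pow h4)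

lemma div_cr (F G : (MvPolynomial (Fin 3) k)) : pderiv 0 (cr F G 0) + pderiv 1 (cr F G 1) + pderiv 2 (cr F G 2) = 0 := by
  rw [cr0, cr1, cr2]
  simp only [map_sub, Derivation.leibniz, smul_eq_mul]
  rw [pd_comm 1 0 F, pd_comm 2 0 F, pd_comm 2 1 F, pd_comm 1 0 G, pd_comm 2 0 G, pd_comm 2 1 G]
  ring

lemma q_ker (hl : IsLND D) {F G q : (MvPolynomial (Fin 3) k)} (hq : ∀ i, cr F G i = q * D (X i)) : D q = 0 := by
  apply ker_of_dvd_self hl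
  have h := div_cr F G
  rw [hq, hq, hq] at h
  simp only [Derivation.leibniz, smul_eq_mul] at h
  refine ⟨-(pderiv 0 (D (X 0)) + pderiv 1 (D (X 1)) + pderiv 2 (D (X 2))), ?_⟩
  rw [der3 D q]
  linear_combination h

lemma cr_Eg {F G : (MvPolynomial (Fin 3) k)} {d e : ℕ} (hF : IsWeightedHomogeneous w F d) (hG : IsWeightedHomogeneous w G e) (i : Fin 3) :
    Eg w (((d : ℤ) + e - (w 0 + w 1 + w 2) + w i : ℤ) : k) (cr F G i) := by
  have hf := fun i => (Eg.of (k := k) hF).pderiv i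
  have hg := fun i => (Eg.of (k := k) hG).pderiv i
  revert i
  apply all3
  · exact (((hf 1).mul (hg 2)).cast (by push_cast; ring)).sub (((hf 2).mul (hg 1)).cast (by push_cast; ring))
  · exact (((hf 2).mul (hg 0)).cast (by push_cast; ring)).sub (((hf 0).mul (hg 2)).cast (by push_cast; ring))
  · exact (((hf 0).mul (hg 1)).cast (by push_cast; ring)).sub (((hf 1).mul (hg 0)).cast (by push_cast; ring))

lemma grad_mem {F G x : (MvPolynomial (Fin 3) k)} (hx : x ∈ Algebra.adjoin k ({F, G} : Set (MvPolynomial (Fin 3) k))) :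
    ∃ a b : (MvPolynomial (Fin 3) k), ∀ i, pderiv i x = a * pderiv i F + b * pderiv i G := by
  induction hx using Algebra.adjoin_induction with
  | mem x hx =>
    rcases hx with rfl | rfl
    · exact ⟨1, 0, fun i => by ring⟩
    · exact ⟨0, 1, fun i => by ring⟩
  | algebraMap r => exact ⟨0, 0, fun i => by rw [Derivation.map_algebraMap]; ring⟩
  | add x y hx hy h1 h2 =>
    obtain ⟨a, b, h⟩ := h1
    obtain ⟨a', b', h'⟩ := h2
    exact ⟨a + a', b + b', fun i => by rw [map_add, h, h']; ring⟩
  | mul x y hx hy h1 h2 =>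
    obtain ⟨a, b, h⟩ := h1
    obtain ⟨a', b', h'⟩ := h2
    exact ⟨x * a' + y * a, x * b' + y * b, fun i => by
      rw [Derivation.leibniz, h, h', smul_eq_mul, smul_eq_mul]; ring⟩

lemma dvd_of_contract {p F : (MvPolynomial (Fin 3) k)} {n d : ℕ} (hp : Prime p) (hpn : IsWeightedHomogeneous w p n)
    (hF : IsWeightedHomogeneous w F d) (hd : 0 < d)
    (h : ∀ i j, p ∣ pderiv i p * pderiv j F - pderiv j p * pderiv i F) : p ∣ F := by
  have h1 := contract hpn hF h
  have : ∃ i, ¬ p ∣ pderiv i p := by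
    by_contra hc
    push Not at hc
    obtain ⟨c, rfl⟩ := const_of_pderiv (fun i => ker_of_dvd_self (lnd_pderiv i) (hc i))
    have hc0 : c ≠ 0 := by rintro rfl; exact hp.ne_zero C_0
    exact not_dvd_C hp hc0 dvd_rfl
  obtain ⟨i, hi⟩ := this
  have h2 : p ∣ C (d : k) * (pderiv i p * F) := by
    have h3 : p ∣ C (n : k) * (p * pderiv i F) := Dvd.dvd.mul_left (dvd_mul_right _ _) _
    have := dvd_add (h1 i) h3
    rwa [sub_add_cancel] at this
  rcases hp.dvd_or_dvd h2 with h3 | h3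
  · exact absurd h3 (not_dvd_C hp (by exact_mod_cast hd.ne'))
  · exact (hp.dvd_or_dvd h3).resolve_left hi

lemma degree_formula (S : Setup w D) (hirr : IsIrreducibleDeriv D) {F G : (MvPolynomial (Fin 3) k)} {d e : ℕ}
    (hF : IsWeightedHomogeneous w F d) (hG : IsWeightedHomogeneous w G e)
    (hd : 0 < d) (he : 0 < e) (hDF : D F = 0) (hDG : D G = 0)
    (hrel : ∀ p, Prime p → p ∣ F → p ∣ G → False) (hF0 : F ≠ 0) (hG0 : G ≠ 0)
    (hk : ∀ r, D r = 0 ↔ r ∈ Algebra.adjoin k ({F, G} : Set (MvPolynomial (Fin 3) k))) (m : ℤ) (hm : DerivIsHomogOfDeg (k := k) w D m) :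
    m = (d : ℤ) + e - (w 0 + w 1 + w 2) := by
  obtain ⟨q, hq⟩ := cr_factor hDF hDG S.ne hirr
  have hq0 : q ≠ 0 := by
    rintro rfl
    exact cr_ne S.hw hF hG hd he hF0 hG0 hrel (fun i => by rw [hq, zero_mul])
  have hDq := q_ker S.lnd hq
  obtain ⟨i, hi⟩ := ex_ne S.ne
  have hci : cr F G i ≠ 0 := by rw [hq]; exact mul_ne_zero hq0 hi
  obtain ⟨n, hn, hcn⟩ := Eg.nat (cr_Eg (k := k) hF hG i) hci
  obtain ⟨nq, nv, hnq, hnv, -⟩ := homog_of_mul (hq i ▸ hcn) (hq i ▸ hci)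
  have hqu : IsUnit q := by
    by_contra hqu
    obtain ⟨p, hp, hpq⟩ := WfDvdMonoid.exists_irreducible_factor hqu hq0
    replace hp := hp.prime
    obtain ⟨np, -, hnp⟩ := homog_of_dvd hnq hq0 hpq
    have hDp : D p = 0 := ker_of_dvd S.lnd hq0 hDq hpq
    obtain ⟨a, b, hab⟩ := grad_mem ((hk p).1 hDp)
    have hcr := cr_antisymm (F := F) (G := G) (p := p) (fun i => by rw [hq]; exact Dvd.dvd.mul_right hpq _)
    apply hrel p hp
    · apply dvd_of_contract hp hnp hF hd
      intro i j
      rw [hab, hab]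
      have : (a * pderiv i F + b * pderiv i G) * pderiv j F - (a * pderiv j F + b * pderiv j G) * pderiv i F
        = (-b) * (pderiv i F * pderiv j G - pderiv j F * pderiv i G) := by ring
      rw [this]
      exact Dvd.dvd.mul_left (hcr i j) _
    · apply dvd_of_contract hp hnp hG he
      intro i j
      rw [hab, hab]
      have : (a * pderiv i F + b * pderiv i G) * pderiv j G - (a * pderiv j F + b * pderiv j G) * pderiv i G
        = a * (pderiv i F * pderiv j G - pderiv j F * pderiv i G) := by ring
      rw [this]
      exact Dvd.dvd.mul_left (hcr i j) _
  have hnq0 : IsWeightedHomogeneous w q 0 := unit_homog hqu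
  obtain ⟨h1, h2⟩ := hm (w i) (X i) (isWeightedHomogeneous_X k w i)
  have hpos : 0 ≤ (w i : ℤ) + m := by
    by_contra hlt
    exact hi (h2 (by omega))
  obtain ⟨j, hj⟩ := Int.eq_ofNat_of_zero_le hpos
  have hv := h1 j hj.symm
  have hc2 : IsWeightedHomogeneous w (cr F G i) (0 + j) := by
    rw [hq]; exact hnq0.mul hv
  have := homog_unique hci hcn hc2
  omega

end Deg
end MZ

/-- Proposition 2.7 (Daigle00result19, parts (a),(b)): for an irreducible homogeneous
nonzero locally nilpotent derivation `D` of `B = k[x,y,z]` graded with `x, y, z` of degrees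
`a, b, c > 0`, the kernel of `D` is `k[F,G]` for homogeneous `F, G`, and if `d = deg F`,
`e = deg G` then the degree of `D` equals `(d + e) - (a + b + c)`. -/
theorem statement_5 (k : Type) [Field k] [CharZero k] (a b c : ℕ)
    (ha : 0 < a) (hb : 0 < b) (hc : 0 < c)
    (D : Derivation k (MvPolynomial (Fin 3) k) (MvPolynomial (Fin 3) k))
    (hlnd : IsLND D) (hirr : IsIrreducibleDeriv D) (hD0 : D ≠ 0)
    (hhom : ∃ m : ℤ, DerivIsHomogOfDeg ![a, b, c] D m) :
    ∃ (F G : MvPolynomial (Fin 3) k) (d e : ℕ),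
      F.IsWeightedHomogeneous ![a, b, c] d ∧
      G.IsWeightedHomogeneous ![a, b, c] e ∧
      (∀ r : MvPolynomial (Fin 3) k,
        D r = 0 ↔ r ∈ Algebra.adjoin k ({F, G} : Set (MvPolynomial (Fin 3) k))) ∧
      (∀ m : ℤ, DerivIsHomogOfDeg ![a, b, c] D m →
        m = (d : ℤ) + (e : ℤ) - ((a : ℤ) + (b : ℤ) + (c : ℤ))) := by
  have S : MZ.Setup ![a, b, c] D := by
    obtain ⟨m, hm⟩ := hhom
    refine ⟨hlnd, MZ.all3 ha hb hc, hD0, fun f n h => MZ.ker_graded hm f n h⟩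
  obtain ⟨F, G, d, e, hF, hG, hd, he, hDF, hDG, hrel, hF0, hG0, hk⟩ := MZ.main_k S
  refine ⟨F, G, d, e, hF, hG, hk, fun m hm => ?_⟩
  exact MZ.degree_formula S hirr hF hG hd he hDF hDG hrel hF0 hG0 hk m hm
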